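/- arXiv:2010.05799 — 2 statements merged into one kernel-verified Lean document; each statement's English description precedes it below -/
import Mathlib

section
/- For all d, p ∈ ℕ there exists an increasing function g : ℕ → ℕ such that, setting ζ_{d,p}(n₁,n₂) = tower(n₂, g(d)·(n₁+1)·(n₁ + ⌈log₂ p⌉)), for every m ∈ ℕ with m ≥ 1: the number of equivalence classes of the relation ≡^MSO_m restricted to the class T_{d,p} is at most ζ_{d,p}(m, d+1) if d ≥ 1, and is exactly p if d = 0. -/
open Cardinal

/-- The tower function: `tower 0 n = n`, `tower (d+1) n = 2 ^ tower d n`. -/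
def tower : ℕ → ℕ → ℕ
  | 0, n => n
  | d + 1, n => 2 ^ tower d n

/-- MSO formulas over the vocabulary consisting of one binary relation symbol `E`
and unary relation symbols indexed by `ι`.  First-order variables and set
variables are both indexed by `ℕ`. -/
inductive MSOForm (ι : Type u) : Type u
  | fal : MSOForm ι
  | eq : ℕ → ℕ → MSOForm ι
  | edge : ℕ → ℕ → MSOForm ι
  | pred : ι → ℕ → MSOForm ι
  | mem : ℕ → ℕ → MSOForm ι
  | imp : MSOForm ι → MSOForm ι → MSOForm ι
  | exFO : ℕ → MSOForm ι → MSOForm ι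
  | exSO : ℕ → MSOForm ι → MSOForm ι

namespace MSOForm

variable {ι : Type u}

/-- Quantifier rank: the maximum nesting depth of (first- and second-order) quantifiers. -/
def qr : MSOForm ι → ℕ
  | fal => 0
  | eq _ _ => 0
  | edge _ _ => 0
  | pred _ _ => 0
  | mem _ _ => 0
  | imp φ ψ => max φ.qr ψ.qr
  | exFO _ φ => φ.qr + 1
  | exSO _ φ => φ.qr + 1

/-- Free first-order variables. -/
def freeFO : MSOForm ι → Finset ℕ
  | fal => ∅
  | eq i j => {i, j}
  | edge i j => {i, j}
  | pred _ i => {i}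
  | mem i _ => {i}
  | imp φ ψ => φ.freeFO ∪ ψ.freeFO
  | exFO n φ => φ.freeFO.erase n
  | exSO _ φ => φ.freeFO

/-- Free set variables. -/
def freeSO : MSOForm ι → Finset ℕ
  | fal => ∅
  | eq _ _ => ∅
  | edge _ _ => ∅
  | pred _ _ => ∅
  | mem _ X => {X}
  | imp φ ψ => φ.freeSO ∪ ψ.freeSO
  | exFO _ φ => φ.freeSO
  | exSO X φ => φ.freeSO.erase X

/-- A sentence is a formula with no free variables of either kind. -/
def IsSentence (φ : MSOForm ι) : Prop := φ.freeFO = ∅ ∧ φ.freeSO = ∅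

/-- First-order formulas: no set quantification and no set membership. -/
def IsFO : MSOForm ι → Prop
  | fal => True
  | eq _ _ => True
  | edge _ _ => True
  | pred _ _ => True
  | mem _ _ => False
  | imp φ ψ => φ.IsFO ∧ ψ.IsFO
  | exFO _ φ => φ.IsFO
  | exSO _ _ => False

/-- Formulas that do not mention the binary relation symbol `E`
(i.e. formulas over a purely monadic vocabulary). -/
def NoEdge : MSOForm ι → Prop
  | fal => True
  | eq _ _ => True
  | edge _ _ => False
  | pred _ _ => True
  | mem _ _ => True
  | imp φ ψ => φ.NoEdge ∧ ψ.NoEdge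
  | exFO _ φ => φ.NoEdge
  | exSO _ φ => φ.NoEdge

end MSOForm

/-- A structure over the vocabulary with one binary relation `E` and `ι`-indexed
unary predicates: a universe, a binary relation and unary relations. -/
structure MStr (ι : Type u) where
  V : Type
  E : V → V → Prop
  P : ι → V → Prop

namespace MStr

/-- Satisfaction of an MSO formula under first-order and set variable assignments. -/
def Realize {ι : Type u} (M : MStr ι) : MSOForm ι → (ℕ → M.V) → (ℕ → Set M.V) → Prop
  | .fal, _, _ => False
  | .eq i j, v, _ => v i = v j
  | .edge i j, v, _ => M.E (v i) (v j)
  | .pred a i, v, _ => M.P a (v i)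
  | .mem i X, v, s => v i ∈ s X
  | .imp φ ψ, v, s => Realize M φ v s → Realize M ψ v s
  | .exFO n φ, v, s => ∃ x : M.V, Realize M φ (Function.update v n x) s
  | .exSO X φ, v, s => ∃ A : Set M.V, Realize M φ v (Function.update s X A)

/-- A structure satisfies a sentence. -/
def Sat {ι : Type u} (M : MStr ι) (φ : MSOForm ι) : Prop :=
  ∀ (v : ℕ → M.V) (s : ℕ → Set M.V), M.Realize φ v s

/-- `M ≡^MSO_m N` : `M` and `N` agree on all MSO sentences of quantifier rank at most `m`. -/
def MSOEquiv {ι : Type u} (m : ℕ) (M N : MStr ι) : Prop :=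
  ∀ φ : MSOForm ι, φ.IsSentence → φ.qr ≤ m → (M.Sat φ ↔ N.Sat φ)

/-- `M` and `N` agree on all MSO sentences. -/
def MSOEq {ι : Type u} (M N : MStr ι) : Prop :=
  ∀ φ : MSOForm ι, φ.IsSentence → (M.Sat φ ↔ N.Sat φ)

/-- `M ≡^FO_q N` over a purely monadic vocabulary: `M` and `N` agree on all
first-order sentences (not mentioning `E`) of quantifier rank at most `q`. -/
def FOEquiv {ι : Type u} (q : ℕ) (M N : MStr ι) : Prop :=
  ∀ φ : MSOForm ι, φ.IsFO → φ.NoEdge → φ.IsSentence → φ.qr ≤ q → (M.Sat φ ↔ N.Sat φ)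

end MStr

/-- A (finite or infinite) `p`-labeled rooted tree: a structure over the vocabulary
`{E, root, P_1, …, P_p}` whose `{E}`-reduct is a tree (connected acyclic graph),
with a distinguished root and every node carrying exactly one label from `Fin p`. -/
structure PTree (p : ℕ) where
  V : Type
  g : SimpleGraph V
  tree : g.IsTree
  root : V
  label : V → Fin p

namespace PTree

variable {p : ℕ}

/-- The tree has height at most `d` (every node is within distance `d` of the root). -/
def heightLe (t : PTree p) (d : ℕ) : Prop := ∀ v, t.g.dist t.root v ≤ d

/-- The tree has height exactly `h`. -/
def heightIs (t : PTree p) (h : ℕ) : Prop :=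
  (∀ v, t.g.dist t.root v ≤ h) ∧ ∃ v, t.g.dist t.root v = h

/-- A `p`-labeled rooted tree as a structure over the vocabulary
`{E, root, P_1, …, P_p}` (`none` indexing the `root` predicate). -/
def toStr (t : PTree p) : MStr (Option (Fin p)) :=
  ⟨t.V, t.g.Adj, fun o v =>
    match o with
    | none => v = t.root
    | some j => t.label v = j⟩

/-- A leaf: a node with no child. -/
def IsLeaf (t : PTree p) (v : t.V) : Prop :=
  ¬ ∃ w, t.g.Adj v w ∧ t.g.dist t.root w = t.g.dist t.root v + 1

end PTree

/-- The setoid of `≡^MSO_m`-equivalence on the class `T_{d,p}`. -/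
def ptreeSetoid (d p m : ℕ) : Setoid {t : PTree p // t.heightLe d} where
  r a b := MStr.MSOEquiv m a.1.toStr b.1.toStr
  iseqv := ⟨fun _ _ _ _ => Iff.rfl, fun h φ h1 h2 => (h φ h1 h2).symm,
    fun h h' φ h1 h2 => (h φ h1 h2).trans (h' φ h1 h2)⟩

section TruncatedCounting

/-- Two cardinalities that agree up to a threshold can be refined along a colouring `g`, with
the colour classes agreeing up to a smaller threshold. -/
theorem exists_pullback_min_encard {X X' D : Type} [Finite D] (g : X → D) {s t : ℕ}
    (ht : 1 ≤ t) (hst : Nat.card D * s ≤ t)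
    (h : min (t : ℕ∞) (ENat.card X) = min (t : ℕ∞) (ENat.card X')) :
    ∃ π : X' → X, ∀ d, min (s : ℕ∞) (g ⁻¹' {d}).encard =
      min (s : ℕ∞) ((g ∘ π) ⁻¹' {d}).encard := by
  classical
  have := Fintype.ofFinite D
  rcases lt_or_ge (ENat.card X) (t : ℕ∞) with hX | hX
  · rw [min_eq_right hX.le] at h
    have hX' : ENat.card X' = ENat.card X := by
      rcases min_choice (t : ℕ∞) (ENat.card X') with h' | h'
      · rw [h'] at h
        exact absurd h hX.ne
      · rw [← h', h]
    have : Finite X := ENat.card_lt_top.1 (hX.trans (ENat.natCast_lt_top t))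
    have : Finite X' := ENat.card_lt_top.1 (hX' ▸ hX.trans (ENat.natCast_lt_top t))
    have hc : Nat.card X' = Nat.card X := by
      simpa [ENat.card_eq_coe_natCard] using hX'
    let e := (Finite.equivFin X').trans ((finCongr hc).trans (Finite.equivFin X).symm)
    refine ⟨e, fun d => ?_⟩
    rw [Set.preimage_comp, Set.encard_preimage_of_bijective e.bijective]
  · have hX' : (t : ℕ∞) ≤ ENat.card X' := by
      rw [min_eq_left hX] at h
      exact min_eq_left_iff.1 h.symm
    have hne : Nonempty X' := by
      rw [← not_isEmpty_iff]
      intro h0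
      have : (t : ℕ∞) ≤ 0 := hX'.trans_eq ((ENat.card_eq_zero_iff_empty _).2 h0)
      have : t ≤ 0 := by exact_mod_cast this
      omega
    obtain ⟨x₀, hx₀⟩ : ∃ x₀, (s : ℕ∞) ≤ (g ⁻¹' {g x₀}).encard := by
      by_contra! hcon
      have hs : ∀ d, (g ⁻¹' {d}).encard ≤ ((s - 1 : ℕ) : ℕ∞) := by
        intro d
        rcases (g ⁻¹' {d}).eq_empty_or_nonempty with h0 | ⟨x, hx⟩
        · simp [h0]
        · have hlt := hcon x
          rw [show g x = d from hx] at hlt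
          obtain ⟨n, hn⟩ := ENat.ne_top_iff_exists.1 (ne_top_of_lt hlt)
          rw [← hn] at hlt ⊢
          norm_cast at hlt ⊢
          omega
      have hsum : ENat.card X ≤ ((Nat.card D * (s - 1) : ℕ) : ℕ∞) := by
        rw [← Set.encard_univ]
        have hU : (Set.univ : Set X) = ⋃ d, g ⁻¹' {d} := by ext x; simp
        rw [hU]
        refine (Set.encard_iUnion_le_of_fintype _).trans ?_
        refine (Finset.sum_le_sum fun d _ => hs d).trans ?_
        simp [Nat.card_eq_fintype_card]
      have h1 : t ≤ Nat.card D * (s - 1) := by exact_mod_cast hX.trans hsum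
      have hXne : Nonempty X := by
        rw [← not_isEmpty_iff]
        intro h0
        have : (t : ℕ∞) ≤ 0 := hX.trans_eq ((ENat.card_eq_zero_iff_empty _).2 h0)
        have : t ≤ 0 := by exact_mod_cast this
        omega
      have hD : 0 < Nat.card D := by
        have : Nonempty D := ⟨g hXne.some⟩
        exact Nat.card_pos
      rcases Nat.eq_zero_or_pos s with hs0 | hs0
      · have := hcon hXne.some
        simp [hs0] at this
      · have : Nat.card D * (s - 1) < Nat.card D * s := Nat.mul_lt_mul_of_pos_left (by omega) hD
        omega
    choose E hEsub hEcard using fun d => Set.exists_subset_encard_eq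
      (min_le_right (s : ℕ∞) (g ⁻¹' {d}).encard)
    have hE : (⋃ d, E d).encard ≤ ((Nat.card D * s : ℕ) : ℕ∞) := by
      refine (Set.encard_iUnion_le_of_fintype _).trans ?_
      refine (Finset.sum_le_sum fun d _ => (hEcard d).trans_le (min_le_left _ _)).trans ?_
      simp [Nat.card_eq_fintype_card]
    have hEX : (⋃ d, E d).encard ≤ (Set.univ : Set X').encard := by
      rw [Set.encard_univ]
      exact hE.trans (le_trans (by exact_mod_cast hst) hX')
    obtain ⟨j, -, hj⟩ := (Set.finite_of_encard_le_coe hE).exists_injOn_of_encard_le hEX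
    let π : X' → X := fun y => if hy : ∃ x ∈ ⋃ d, E d, j x = y then hy.choose else x₀
    have hπj : ∀ x ∈ ⋃ d, E d, π (j x) = x := by
      intro x hx
      have hy : ∃ x' ∈ ⋃ d, E d, j x' = j x := ⟨x, hx, rfl⟩
      simp only [π, dif_pos hy]
      exact hj hy.choose_spec.1 hx hy.choose_spec.2
    have himg : ∀ d, (j '' E d).encard = min (s : ℕ∞) (g ⁻¹' {d}).encard := fun d => by
      rw [(hj.mono (Set.subset_iUnion E d)).encard_image, hEcard]
    have hsub : ∀ d, j '' E d ⊆ (g ∘ π) ⁻¹' {d} := by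
      rintro d _ ⟨x, hx, rfl⟩
      simpa [hπj x (Set.mem_iUnion_of_mem d hx)] using hEsub d hx
    refine ⟨π, fun d => ?_⟩
    by_cases hd : d = g x₀
    · subst hd
      have h1 := Set.encard_le_encard (hsub (g x₀))
      rw [himg, min_eq_left hx₀] at h1
      rw [min_eq_left hx₀, min_eq_left h1]
    · have heq : (g ∘ π) ⁻¹' {d} = j '' E d := by
        refine Set.Subset.antisymm (fun y hy => ?_) (hsub d)
        by_cases hex : ∃ x ∈ ⋃ d, E d, j x = y
        · obtain ⟨x, hx, rfl⟩ := hex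
          have hgx : g x = d := by simpa [hπj x hx] using hy
          obtain ⟨d', hd'⟩ := Set.mem_iUnion.1 hx
          have : g x = d' := hEsub d' hd'
          exact ⟨x, by rw [← hgx, this]; exact hd', rfl⟩
        · have : g (π y) = d := hy
          simp only [π, dif_neg hex] at this
          exact absurd this.symm hd
      rw [heq, himg, ← min_assoc, min_self]

theorem min_add_eq_min_min_add_min (s a b : ℕ∞) :
    min s (a + b) = min s (min s a + min s b) := by
  rcases le_total s a with ha | ha
  · rw [min_eq_left ha, min_eq_left (ha.trans le_self_add), min_eq_left le_self_add]
  · rcases le_total s b with hb | hb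
    · rw [min_eq_left hb, min_eq_left (hb.trans le_add_self), min_eq_left le_add_self]
    · rw [min_eq_right ha, min_eq_right hb]

theorem min_sum_congr {C : Type} (F : Finset C) (s : ℕ∞) {a b : C → ℕ∞}
    (h : ∀ c, min s (a c) = min s (b c)) : min s (∑ c ∈ F, a c) = min s (∑ c ∈ F, b c) := by
  classical
  induction F using Finset.induction_on with
  | empty => simp
  | insert c F hc ih =>
    rw [Finset.sum_insert hc, Finset.sum_insert hc, min_add_eq_min_min_add_min, h, ih,
      ← min_add_eq_min_min_add_min]

theorem encard_eq_sum_fiber {X C : Type} [Fintype C] (f : X → C) (A : Set X) :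
    A.encard = ∑ c, (f ⁻¹' {c} ∩ A).encard := by
  have hA : A = ⋃ c, f ⁻¹' {c} ∩ A := by ext x; simp
  conv_lhs => rw [hA]
  rw [Set.encard_iUnion_of_finite, finsum_eq_sum_of_fintype]
  intro c c' hcc
  refine Set.disjoint_left.2 fun x hx hx' => hcc ?_
  exact hx.1.symm.trans hx'.1

/-- A coloured family can be matched with another one having the same colour multiplicities up
to `t`, in such a way that the multiplicities of a second colouring agree up to `s`. -/
theorem exists_matching_min_encard {I I' C D : Type} [Finite C] [Finite D] (f : I → C)
    (f' : I' → C) (g : I → D) {s t : ℕ} (ht : 1 ≤ t) (hst : Nat.card D * s ≤ t)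
    (h : ∀ c, min (t : ℕ∞) (f ⁻¹' {c}).encard = min (t : ℕ∞) (f' ⁻¹' {c}).encard) :
    ∃ π : I' → I, (∀ i, f (π i) = f' i) ∧
      ∀ d, min (s : ℕ∞) (g ⁻¹' {d}).encard = min (s : ℕ∞) ((g ∘ π) ⁻¹' {d}).encard := by
  have := Fintype.ofFinite C
  choose π hπ using fun c => exists_pullback_min_encard (X := f ⁻¹' {c}) (X' := f' ⁻¹' {c})
    (fun i => g i) ht hst (h c)
  refine ⟨fun i => π (f' i) ⟨i, rfl⟩, fun i => (π (f' i) ⟨i, rfl⟩).2, fun d => ?_⟩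
  rw [encard_eq_sum_fiber f, encard_eq_sum_fiber f' ((g ∘ _) ⁻¹' {d})]
  refine min_sum_congr _ _ fun c => ?_
  have h1 : f ⁻¹' {c} ∩ g ⁻¹' {d} =
      Subtype.val '' ((fun i : f ⁻¹' {c} => g i) ⁻¹' {d}) := by
    ext i; simp [and_comm]
  have h2 : f' ⁻¹' {c} ∩ (g ∘ fun i => (π (f' i) ⟨i, rfl⟩ : I)) ⁻¹' {d} =
      Subtype.val '' (((fun i : f ⁻¹' {c} => g i) ∘ π c) ⁻¹' {d}) := by
    ext i
    constructor
    · rintro ⟨rfl, hi⟩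
      exact ⟨⟨i, rfl⟩, hi, rfl⟩
    · rintro ⟨⟨_, rfl⟩, hi, rfl⟩
      exact ⟨rfl, hi⟩
  rw [h1, h2, Subtype.val_injective.encard_image, Subtype.val_injective.encard_image, hπ]

end TruncatedCounting

section Tower

theorem tower_mono (d : ℕ) : Monotone (tower d) := by
  induction d with
  | zero => exact fun _ _ h => h
  | succ d ih => exact fun _ _ h => Nat.pow_le_pow_right (by norm_num) (ih h)

theorem le_tower (d n : ℕ) : n ≤ tower d n := by
  induction d with
  | zero => exact le_rfl
  | succ d ih => exact ih.trans Nat.lt_two_pow_self.le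

theorem four_mul_tower_le (d : ℕ) {n : ℕ} (hn : 1 ≤ n) : 4 * tower d n ≤ tower d (4 * n) := by
  induction d with
  | zero => exact le_rfl
  | succ d ih =>
    have h1 : 1 ≤ tower d n := hn.trans (le_tower d n)
    calc 4 * 2 ^ tower d n = 2 ^ (2 + tower d n) := by rw [pow_add]; norm_num
      _ ≤ 2 ^ tower d (4 * n) := Nat.pow_le_pow_right (by norm_num) (by omega)

/-- The number of codes of height `h` over `q` labels, with multiplicities truncated
according to `τ`. -/
def codeCard (τ : ℕ → ℕ) (q : ℕ) : ℕ → ℕ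
  | 0 => q
  | h + 1 => q * (τ h + 1) ^ codeCard τ q h

/-- Thresholds for which codes over `q` labels determine the truth of sentences of quantifier
rank `m`. -/
def threshold : ℕ → ℕ → ℕ → ℕ
  | 0, _, _ => 2
  | m + 1, q, h => codeCard (threshold m (q * 2)) (q * 2) h * threshold m (q * 2) h

theorem codeCard_pos (τ : ℕ → ℕ) {q : ℕ} (hq : 1 ≤ q) (h : ℕ) : 1 ≤ codeCard τ q h := by
  cases h with
  | zero => exact hq
  | succ h => exact Nat.mul_pos hq (by positivity)

theorem two_le_threshold (m : ℕ) {q : ℕ} (hq : 1 ≤ q) (h : ℕ) : 2 ≤ threshold m q h := by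
  induction m generalizing q with
  | zero => exact le_rfl
  | succ m ih =>
    have h1 := codeCard_pos (threshold m (q * 2)) (q := q * 2) (by omega) h
    have h2 := ih (q := q * 2) (by omega)
    exact h2.trans (Nat.le_mul_of_pos_left _ h1)

theorem codeCard_threshold_le (h m q a : ℕ) (hq : q ≤ 2 ^ a) :
    codeCard (threshold m q) q h ≤ tower (h + 1) (4 ^ h * ((m + 1) * (m + a + 1))) := by
  induction h generalizing m q a with
  | zero =>
    refine hq.trans (Nat.pow_le_pow_right (by norm_num) ?_)
    simp only [tower, pow_zero, one_mul]
    nlinarith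
  | succ h ih =>
    obtain ⟨K, hK⟩ : ∃ K, K = m + a + 1 := ⟨_, rfl⟩
    set X := 4 ^ h * ((m + 1) * K) with hX
    have hXK : K ≤ X := by
      rw [hX]
      have h4 : 1 ≤ 4 ^ h := Nat.one_le_pow _ _ (by norm_num)
      nlinarith [Nat.zero_le (m * K)]
    set T := tower (h + 1) X with hT
    have hthr : ∀ j ≤ m, ∀ q' a', q' ≤ 2 ^ a' → j + a' + 1 = K →
        threshold j q' h ≤ 2 * T ^ j := by
      intro j
      induction j with
      | zero => intros; simp [threshold]
      | succ j ihj =>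
        intro hj q' a' hq' hK'
        have hq2 : q' * 2 ≤ 2 ^ (a' + 1) := by rw [pow_succ]; omega
        have h1 := ihj (by omega) (q' * 2) (a' + 1) hq2 (by omega)
        have h2 : codeCard (threshold j (q' * 2)) (q' * 2) h ≤ T := by
          refine (ih j _ _ hq2).trans (tower_mono _ ?_)
          rw [show j + (a' + 1) + 1 = K by omega]
          exact Nat.mul_le_mul_left _ (Nat.mul_le_mul_right _ (by omega))
        calc threshold (j + 1) q' h
            = codeCard (threshold j (q' * 2)) (q' * 2) h * threshold j (q' * 2) h := rfl
          _ ≤ T * (2 * T ^ j) := Nat.mul_le_mul h2 h1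
          _ = 2 * T ^ (j + 1) := by ring
    have h0 := hthr m le_rfl q a hq hK.symm
    have hN : codeCard (threshold m q) q h ≤ T := by
      have := ih m q a hq
      rwa [← hK] at this
    set S := tower h X with hS
    have hTS : T = 2 ^ S := rfl
    have hXS : X ≤ S := le_tower h X
    have hST : S + 1 ≤ T := hTS ▸ Nat.lt_two_pow_self
    have hT2 : 2 ≤ T := by omega
    have hbase : threshold m q h + 1 ≤ T ^ (m + 2) := by
      have hp : 1 ≤ T ^ m := Nat.one_le_pow _ _ (by omega)
      have h4 : 4 ≤ T * T := by nlinarith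
      calc threshold m q h + 1 ≤ 4 * T ^ m := by omega
        _ ≤ T * T * T ^ m := Nat.mul_le_mul_right _ h4
        _ = T ^ (m + 2) := by ring
    have hexp : a + S * (m + 2) * T ≤ tower (h + 1) (4 ^ (h + 1) * ((m + 1) * K)) := by
      have ha : a ≤ T := by omega
      have hm : m + 2 ≤ T := by omega
      have h3 : S * (m + 2) * T ≤ T * T * T :=
        Nat.mul_le_mul_right _ (Nat.mul_le_mul (by omega) hm)
      have h5 : T + T * T * T ≤ T ^ 4 := by
        have : 4 ≤ T * T := by nlinarith
        have h6 : T ≤ T * T * T := by nlinarith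
        calc T + T * T * T ≤ T * T * T * 2 := by omega
          _ ≤ T * T * T * T := Nat.mul_le_mul_left _ hT2
          _ = T ^ 4 := by ring
      calc a + S * (m + 2) * T ≤ T ^ 4 := by omega
        _ = 2 ^ (4 * S) := by rw [hTS, ← pow_mul, mul_comm]
        _ ≤ 2 ^ tower h (4 * X) :=
          Nat.pow_le_pow_right (by norm_num) (four_mul_tower_le h (by omega))
        _ = tower (h + 1) (4 ^ (h + 1) * ((m + 1) * K)) := by
          rw [hX, pow_succ, mul_comm (4 ^ h) 4, mul_assoc 4]; rfl
    rw [← hK]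
    calc codeCard (threshold m q) q (h + 1)
        = q * (threshold m q h + 1) ^ codeCard (threshold m q) q h := rfl
      _ ≤ 2 ^ a * (T ^ (m + 2)) ^ T := by
        refine Nat.mul_le_mul hq ((Nat.pow_le_pow_left hbase _).trans ?_)
        exact Nat.pow_le_pow_right (Nat.pos_of_ne_zero (by positivity)) hN
      _ = 2 ^ (a + S * (m + 2) * T) := by
        rw [hTS, ← pow_mul, ← pow_mul, ← pow_add, mul_assoc S]
      _ ≤ tower (h + 1 + 1) (4 ^ (h + 1) * ((m + 1) * K)) :=
        Nat.pow_le_pow_right (by norm_num) hexp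

end Tower

section Shapes

/-- Shapes of rooted trees of height at most `h`. -/
def Shape : ℕ → Type 1
  | 0 => PUnit
  | h + 1 => Σ I : Type, I → Shape h

namespace Shape

/-- The nodes of a shape. -/
def Node : (h : ℕ) → Shape h → Type
  | 0, _ => Unit
  | h + 1, s => Option (Σ i : s.1, Node h (s.2 i))

/-- The root node of a shape. -/
def rootNode : (h : ℕ) → (s : Shape h) → Node h s
  | 0, _ => ()
  | _ + 1, _ => none

theorem sigma_mk_inj {h : ℕ} {s : Shape (h + 1)} {i j : s.1} {a : Node h (s.2 i)}
    {b : Node h (s.2 j)} (hab : (some ⟨i, a⟩ : Node (h + 1) s) = some ⟨j, b⟩) :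
    i = j ∧ a ≍ b :=
  Sigma.mk.inj_iff.1 (Option.some.inj hab)

/-- `IsChild h s a b` says that `b` is a child of `a`. -/
inductive IsChild : (h : ℕ) → (s : Shape h) → Node h s → Node h s → Prop
  | root {h : ℕ} (s : Shape (h + 1)) (i : s.1) :
      IsChild (h + 1) s none (some ⟨i, rootNode h (s.2 i)⟩)
  | sub {h : ℕ} (s : Shape (h + 1)) (i : s.1) (a b : Node h (s.2 i)) :
      IsChild h (s.2 i) a b → IsChild (h + 1) s (some ⟨i, a⟩) (some ⟨i, b⟩)

/-- The labelling of the `i`-th subtree induced by a labelling of the whole tree. -/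
def restrict {h : ℕ} {s : Shape (h + 1)} {L : Type} (f : Node (h + 1) s → L) (i : s.1) :
    Node h (s.2 i) → L :=
  fun n => f (some ⟨i, n⟩)

/-- Codes of labelled trees of height at most `h`: the label of the root together with the
multiplicities, truncated at `τ`, of the codes of its immediate subtrees. -/
def Code (τ : ℕ → ℕ) (L : Type) : ℕ → Type
  | 0 => L
  | h + 1 => L × (Code τ L h → Fin (τ h + 1))

instance finite_code (τ : ℕ → ℕ) (L : Type) [Finite L] : (h : ℕ) → Finite (Code τ L h)
  | 0 => inferInstanceAs (Finite L)
  | h + 1 =>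
    have := finite_code τ L h
    inferInstanceAs (Finite (L × (Code τ L h → Fin (τ h + 1))))

theorem card_code (τ : ℕ → ℕ) (L : Type) [Finite L] (h : ℕ) :
    Nat.card (Code τ L h) = codeCard τ (Nat.card L) h := by
  induction h with
  | zero => rfl
  | succ h ih =>
    have hfin := finite_code τ L h
    have := Fintype.ofFinite (Code τ L h)
    change Nat.card (L × (Code τ L h → Fin (τ h + 1))) = _
    rw [Nat.card_prod, Nat.card_fun, Nat.card_fin, ih]
    rfl

/-- The cardinality of a set, truncated at `t`. -/
noncomputable def truncCard {X : Type} (t : ℕ) (A : Set X) : Fin (t + 1) :=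
  ⟨(min (t : ℕ∞) A.encard).toNat, by
    have : (min (t : ℕ∞) A.encard).toNat ≤ t := ENat.toNat_le_of_le_natCast (min_le_left _ _)
    omega⟩

theorem truncCard_eq_iff {X X' : Type} {t : ℕ} {A : Set X} {A' : Set X'} :
    truncCard t A = truncCard t A' ↔ min (t : ℕ∞) A.encard = min (t : ℕ∞) A'.encard := by
  have h1 : ∀ a : ℕ∞, min (t : ℕ∞) a ≠ ⊤ := fun a =>
    ne_top_of_le_ne_top (ENat.natCast_ne_top t) (min_le_left _ _)
  rw [truncCard, truncCard, Fin.mk.injEq]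
  exact ⟨fun h => by rw [← ENat.natCast_toNat (h1 A.encard), h, ENat.natCast_toNat (h1 _)],
    fun h => by rw [h]⟩

/-- The code of a labelled tree. -/
noncomputable def code (τ : ℕ → ℕ) {L : Type} :
    (h : ℕ) → (s : Shape h) → (Node h s → L) → Code τ L h
  | 0, _, f => f ()
  | h + 1, s, f => (f none, fun c => truncCard (τ h) {i | code τ h (s.2 i) (restrict f i) = c})

variable {τ : ℕ → ℕ} {L : Type}

theorem code_succ_eq_iff {h : ℕ} {s s' : Shape (h + 1)} {f : Node (h + 1) s → L}
    {f' : Node (h + 1) s' → L} :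
    code τ (h + 1) s f = code τ (h + 1) s' f' ↔ f none = f' none ∧
      ∀ c, min (τ h : ℕ∞) ((fun i => code τ h (s.2 i) (restrict f i)) ⁻¹' {c}).encard =
        min (τ h : ℕ∞) ((fun i => code τ h (s'.2 i) (restrict f' i)) ⁻¹' {c}).encard := by
  refine Prod.ext_iff.trans (and_congr Iff.rfl (funext_iff.trans (forall_congr' fun c => ?_)))
  exact truncCard_eq_iff

theorem label_root_eq {h : ℕ} {s s' : Shape h} {f : Node h s → L} {f' : Node h s' → L}
    (hc : code τ h s f = code τ h s' f') : f (rootNode h s) = f' (rootNode h s') := by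
  cases h with
  | zero => exact hc
  | succ h => exact (code_succ_eq_iff.1 hc).1

theorem exists_subtree_code_eq (hτ : ∀ h, 2 ≤ τ h) {h : ℕ} {s s' : Shape (h + 1)}
    {f : Node (h + 1) s → L} {f' : Node (h + 1) s' → L}
    (hc : code τ (h + 1) s f = code τ (h + 1) s' f') (i : s.1) :
    ∃ i', code τ h (s.2 i) (restrict f i) = code τ h (s'.2 i') (restrict f' i') := by
  have hcc := (code_succ_eq_iff.1 hc).2 (code τ h (s.2 i) (restrict f i))
  by_contra! hcon
  rw [Set.encard_eq_zero.2 (Set.eq_empty_of_forall_notMem fun i' hi' => hcon i' hi'.symm),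
    min_eq_right zero_le] at hcc
  rcases min_choice (τ h : ℕ∞)
    ((fun i => code τ h (s.2 i) (restrict f i)) ⁻¹' {code τ h (s.2 i) (restrict f i)}).encard
    with h' | h'
  · rw [h'] at hcc
    have h1 : τ h = 0 := by exact_mod_cast hcc
    have := hτ h
    omega
  · rw [h', Set.encard_eq_zero] at hcc
    exact (Set.eq_empty_iff_forall_notMem.1 hcc) i rfl

theorem exists_ne_subtree_code_eq (hτ : ∀ h, 2 ≤ τ h) {h : ℕ} {s s' : Shape (h + 1)}
    {f : Node (h + 1) s → L} {f' : Node (h + 1) s' → L}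
    (hc : code τ (h + 1) s f = code τ (h + 1) s' f') {i j : s.1} (hij : i ≠ j)
    (hcij : code τ h (s.2 i) (restrict f i) = code τ h (s.2 j) (restrict f j)) (i' : s'.1) :
    ∃ j', j' ≠ i' ∧
      code τ h (s.2 i) (restrict f i) = code τ h (s'.2 j') (restrict f' j') := by
  have hcc := (code_succ_eq_iff.1 hc).2 (code τ h (s.2 i) (restrict f i))
  set B := (fun i => code τ h (s'.2 i) (restrict f' i)) ⁻¹' {code τ h (s.2 i) (restrict f i)}
  have h2 : (2 : ℕ∞) ≤ min (τ h : ℕ∞) B.encard := by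
    rw [← hcc]
    refine le_min (by exact_mod_cast hτ h) ?_
    rw [← Set.encard_pair hij]
    refine Set.encard_le_encard ?_
    rintro x (rfl | rfl)
    · rfl
    · exact hcij.symm
  have h1 : 1 < B.encard := lt_of_lt_of_le (by norm_num) (h2.trans (min_le_right _ _))
  obtain ⟨j', hj', hne⟩ := Set.exists_ne_of_one_lt_encard h1 i'
  exact ⟨j', hne, hj'.symm⟩

theorem exists_label_eq (hτ : ∀ h, 2 ≤ τ h) {h : ℕ} {s s' : Shape h} {f : Node h s → L}
    {f' : Node h s' → L} (hc : code τ h s f = code τ h s' f') (n : Node h s) :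
    ∃ n', f n = f' n' := by
  induction h with
  | zero => exact ⟨(), hc⟩
  | succ h ih =>
    match n with
    | none => exact ⟨none, (code_succ_eq_iff.1 hc).1⟩
    | some ⟨i, n⟩ =>
      obtain ⟨i', hi'⟩ := exists_subtree_code_eq hτ hc i
      obtain ⟨n', hn'⟩ := ih hi' n
      exact ⟨some ⟨i', n'⟩, hn'⟩

theorem exists_isChild_label_eq (hτ : ∀ h, 2 ≤ τ h) {h : ℕ} {s s' : Shape h}
    {f : Node h s → L} {f' : Node h s' → L} (hc : code τ h s f = code τ h s' f')
    {a b : Node h s} (hab : IsChild h s a b) :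
    ∃ a' b', IsChild h s' a' b' ∧ f a = f' a' ∧ f b = f' b' := by
  induction hab with
  | root s i =>
    obtain ⟨i', hi'⟩ := exists_subtree_code_eq hτ hc i
    exact ⟨none, _, .root s' i', (code_succ_eq_iff.1 hc).1, label_root_eq hi'⟩
  | sub s i a b _ ih =>
    obtain ⟨i', hi'⟩ := exists_subtree_code_eq hτ hc i
    obtain ⟨a', b', hab', ha, hb⟩ := ih hi'
    exact ⟨_, _, .sub s' i' a' b' hab', ha, hb⟩

theorem existsUnique_label (hτ : ∀ h, 2 ≤ τ h) (Q : L → Prop) {h : ℕ} {s s' : Shape h}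
    {f : Node h s → L} {f' : Node h s' → L} (hc : code τ h s f = code τ h s' f')
    {n : Node h s} (hn : ∀ x, Q (f x) ↔ x = n) : ∃ n', ∀ x, Q (f' x) ↔ x = n' := by
  induction h with
  | zero =>
    refine ⟨(), fun x => ⟨fun _ => rfl, ?_⟩⟩
    rintro rfl
    have : f () = f' () := hc
    exact this ▸ (hn ()).2 rfl
  | succ h ih =>
    have hroot := (code_succ_eq_iff.1 hc).1
    match n with
    | none =>
      refine ⟨none, fun x => ⟨fun hx => ?_, ?_⟩⟩
      · match x with
        | none => rfl
        | some ⟨i', x⟩ =>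
          obtain ⟨i, hi⟩ := exists_subtree_code_eq hτ hc.symm i'
          obtain ⟨y, hy⟩ := exists_label_eq hτ hi x
          have : Q (f (some ⟨i, y⟩)) := (show f' (some ⟨i', x⟩) = f (some ⟨i, y⟩) from hy) ▸ hx
          exact absurd ((hn _).1 this) (by simp)
      · rintro rfl
        exact hroot ▸ (hn none).2 rfl
    | some ⟨i, n⟩ =>
      obtain ⟨i', hi'⟩ := exists_subtree_code_eq hτ hc i
      have hn0 : ∀ x, Q (restrict f i x) ↔ x = n := fun x => by
        refine (hn _).trans ⟨fun hx => ?_, fun hx => by rw [hx]⟩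
        exact eq_of_heq (sigma_mk_inj hx).2
      have hsub : ∀ j x, Q (restrict f j x) → j = i := fun j x hx =>
        (sigma_mk_inj ((hn (some ⟨j, x⟩)).1 hx)).1
      obtain ⟨n', hn'⟩ := ih hi' hn0
      refine ⟨some ⟨i', n'⟩, fun x => ⟨fun hx => ?_, ?_⟩⟩
      · match x with
        | none => exact absurd ((hn none).1 (hroot ▸ hx)) (by simp)
        | some ⟨j', x⟩ =>
          by_cases hj : j' = i'
          · subst hj
            rw [(hn' x).1 hx]
          · exfalso
            obtain ⟨j, hcj⟩ := exists_subtree_code_eq hτ hc.symm j'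
            obtain ⟨y, hy⟩ := exists_label_eq hτ hcj x
            have hij : j = i := hsub j y (hy ▸ hx)
            subst hij
            obtain ⟨k, hk, hck⟩ := exists_ne_subtree_code_eq hτ hc.symm hj (hcj.trans hi') j
            obtain ⟨z, hz⟩ := exists_label_eq hτ (hcj.symm.trans hck) y
            exact hk (hsub k z (hz ▸ hy ▸ hx))
      · rintro rfl
        exact (hn' _).2 rfl

/-- The labelling obtained by additionally marking the nodes in `A`. -/
def mark {h : ℕ} {s : Shape h} (f : Node h s → L) (A : Set (Node h s)) :
    Node h s → L × Prop :=
  fun n => (f n, n ∈ A)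

theorem exists_mark_code_eq [Finite L] {τ' : ℕ → ℕ} (hτ : ∀ h, 1 ≤ τ h)
    (hττ' : ∀ h, Nat.card (Code τ' (L × Prop) h) * τ' h ≤ τ h) {h : ℕ} {s s' : Shape h}
    {f : Node h s → L} {f' : Node h s' → L} (hc : code τ h s f = code τ h s' f')
    (A : Set (Node h s)) :
    ∃ A' : Set (Node h s'), code τ' h s (mark f A) = code τ' h s' (mark f' A') := by
  induction h with
  | zero =>
    refine ⟨A, Prod.ext hc rfl⟩
  | succ h ih =>
    obtain ⟨hroot, hcount⟩ := code_succ_eq_iff.1 hc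
    obtain ⟨π, hπ, hπc⟩ := exists_matching_min_encard _ _
      (fun i => code τ' h (s.2 i) (restrict (mark f A) i)) (hτ h) (hττ' h) hcount
    choose A' hA' using fun i' => ih (hπ i') {n | some ⟨π i', n⟩ ∈ A}
    refine ⟨{x | Option.elim x (none ∈ A) fun y => y.2 ∈ A' y.1}, ?_⟩
    refine code_succ_eq_iff.2 ⟨Prod.ext hroot rfl, fun c => ?_⟩
    rw [hπc c]
    congr 3
    funext i'
    exact hA' i'

end Shape

end Shapes

namespace Shape

theorem exists_mark_singleton_code_eq {L : Type} [Finite L] {τ τ' : ℕ → ℕ} (hτ : ∀ h, 1 ≤ τ h)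
    (hτ' : ∀ h, 2 ≤ τ' h) (hττ' : ∀ h, Nat.card (Code τ' (L × Prop) h) * τ' h ≤ τ h) {h : ℕ}
    {s s' : Shape h} {f : Node h s → L} {f' : Node h s' → L}
    (hc : code τ h s f = code τ h s' f') (n : Node h s) :
    ∃ n', code τ' h s (mark f {n}) = code τ' h s' (mark f' {n'}) := by
  obtain ⟨A', hA'⟩ := exists_mark_code_eq hτ hττ' hc {n}
  obtain ⟨n', hn'⟩ := existsUnique_label hτ' Prod.snd hA' (n := n) fun x => Iff.rfl
  obtain rfl : A' = {n'} := Set.ext hn'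
  exact ⟨_, hA'⟩

/-- The relational structure of a labelled shape. -/
def toStr {p h : ℕ} (s : Shape h) (lab : Node h s → Fin p) : MStr (Option (Fin p)) :=
  ⟨Node h s, fun a b => IsChild h s a b ∨ IsChild h s b a, fun o v =>
    match o with
    | none => v = rootNode h s
    | some j => lab v = j⟩

theorem card_prod_prop (L : Type) : Nat.card (L × Prop) = Nat.card L * 2 := by
  rw [Nat.card_prod, Nat.card_eq_fintype_card (α := Prop), Fintype.card_prop]

/-- `threshold m` is large enough to play one round of the Ehrenfeucht–Fraïssé game from
`threshold (m + 1)`. -/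
theorem card_code_mul_threshold {L : Type} [Finite L] (m h : ℕ) :
    Nat.card (Code (threshold m (Nat.card L * 2)) (L × Prop) h) *
      threshold m (Nat.card L * 2) h = threshold (m + 1) (Nat.card L) h := by
  rw [card_code, card_prod_prop]
  rfl

theorem label_eq_of_definable {L : Type} {τ : ℕ → ℕ} (hτ : ∀ h, 2 ≤ τ h) {h : ℕ}
    {s s' : Shape h} {f : Node h s → L} {f' : Node h s' → L}
    (hc : code τ h s f = code τ h s' f') {Q : L → Prop} {n : Node h s} {n' : Node h s'}
    (hQ : ∀ x, Q (f x) ↔ x = n) (hQ' : ∀ x, Q (f' x) ↔ x = n') : f n = f' n' := by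
  obtain ⟨x, hx⟩ := exists_label_eq hτ hc n
  rw [hx, (hQ' x).1 (hx ▸ (hQ n).2 rfl)]

theorem isChild_of_definable {L : Type} {τ : ℕ → ℕ} (hτ : ∀ h, 2 ≤ τ h) {h : ℕ}
    {s s' : Shape h} {f : Node h s → L} {f' : Node h s' → L}
    (hc : code τ h s f = code τ h s' f') {Q₁ Q₂ : L → Prop} {a b : Node h s} {a' b' : Node h s'}
    (hQ₁ : ∀ x, Q₁ (f x) ↔ x = a) (hQ₁' : ∀ x, Q₁ (f' x) ↔ x = a')
    (hQ₂ : ∀ x, Q₂ (f x) ↔ x = b) (hQ₂' : ∀ x, Q₂ (f' x) ↔ x = b')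
    (hab : IsChild h s a b) : IsChild h s' a' b' := by
  obtain ⟨x, y, hxy, hx, hy⟩ := exists_isChild_label_eq hτ hc hab
  rwa [(hQ₁' x).1 (hx ▸ (hQ₁ a).2 rfl), (hQ₂' y).1 (hy ▸ (hQ₂ b).2 rfl)] at hxy

/-- Two labelled trees with the same code satisfy the same formulas of quantifier rank at most
`m`, provided that the values of the free variables are definable from the labels. -/
theorem realize_iff_of_code_eq {p h : ℕ} {s s' : Shape h} {lab : Node h s → Fin p}
    {lab' : Node h s' → Fin p} (φ : MSOForm (Option (Fin p))) :
    ∀ (m : ℕ), φ.qr ≤ m → ∀ (L : Type) [Finite L] (f : Node h s → L) (f' : Node h s' → L),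
      code (threshold m (Nat.card L)) h s f = code (threshold m (Nat.card L)) h s' f' →
      ∀ R : L → Fin p, (∀ x, lab x = R (f x)) → (∀ x, lab' x = R (f' x)) →
      ∀ (v : ℕ → Node h s) (v' : ℕ → Node h s') (S : ℕ → Set (Node h s))
        (S' : ℕ → Set (Node h s')),
      (∀ i ∈ φ.freeFO, ∃ Q : L → Prop, (∀ x, Q (f x) ↔ x = v i) ∧ ∀ x, Q (f' x) ↔ x = v' i) →
      (∀ X ∈ φ.freeSO, ∃ Q : L → Prop, (∀ x, Q (f x) ↔ x ∈ S X) ∧ ∀ x, Q (f' x) ↔ x ∈ S' X) →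
      ((toStr s lab).Realize φ v S ↔ (toStr s' lab').Realize φ v' S') := by
  induction φ with
  | fal => intros; exact Iff.rfl
  | eq i j =>
    intro m _ L _ f f' hc R _ _ v v' S S' hv _
    have hτ := two_le_threshold m (q := Nat.card L)
      (have : Nonempty L := ⟨f (rootNode h s)⟩; Nat.card_pos)
    obtain ⟨Q, hQ, hQ'⟩ := hv i (by simp [MSOForm.freeFO])
    obtain ⟨Q₂, hQ₂, hQ₂'⟩ := hv j (by simp [MSOForm.freeFO])
    have hj := label_eq_of_definable hτ hc hQ₂ hQ₂'
    change v i = v j ↔ v' i = v' j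
    rw [eq_comm, ← hQ, hj, hQ', eq_comm]
  | edge i j =>
    intro m _ L _ f f' hc R _ _ v v' S S' hv _
    have hτ := two_le_threshold m (q := Nat.card L)
      (have : Nonempty L := ⟨f (rootNode h s)⟩; Nat.card_pos)
    obtain ⟨Q, hQ, hQ'⟩ := hv i (by simp [MSOForm.freeFO])
    obtain ⟨Q₂, hQ₂, hQ₂'⟩ := hv j (by simp [MSOForm.freeFO])
    exact or_congr
      ⟨isChild_of_definable hτ hc hQ hQ' hQ₂ hQ₂',
        isChild_of_definable hτ hc.symm hQ' hQ hQ₂' hQ₂⟩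
      ⟨isChild_of_definable hτ hc hQ₂ hQ₂' hQ hQ',
        isChild_of_definable hτ hc.symm hQ₂' hQ₂ hQ' hQ⟩
  | pred a i =>
    intro m _ L _ f f' hc R hR hR' v v' S S' hv _
    have hτ := two_le_threshold m (q := Nat.card L)
      (have : Nonempty L := ⟨f (rootNode h s)⟩; Nat.card_pos)
    obtain ⟨Q, hQ, hQ'⟩ := hv i (by simp [MSOForm.freeFO])
    cases a with
    | none =>
      change v i = rootNode h s ↔ v' i = rootNode h s'
      rw [eq_comm, ← hQ, label_root_eq hc, hQ', eq_comm]
    | some j =>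
      change lab (v i) = j ↔ lab' (v' i) = j
      rw [hR, hR', label_eq_of_definable hτ hc hQ hQ']
  | mem i X =>
    intro m _ L _ f f' hc R _ _ v v' S S' hv hS
    have hτ := two_le_threshold m (q := Nat.card L)
      (have : Nonempty L := ⟨f (rootNode h s)⟩; Nat.card_pos)
    obtain ⟨Q, hQ, hQ'⟩ := hv i (by simp [MSOForm.freeFO])
    obtain ⟨Q₂, hQ₂, hQ₂'⟩ := hS X (by simp [MSOForm.freeSO])
    change v i ∈ S X ↔ v' i ∈ S' X
    rw [← hQ₂, ← hQ₂', label_eq_of_definable hτ hc hQ hQ']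
  | imp φ ψ ihφ ihψ =>
    intro m hm L _ f f' hc R hR hR' v v' S S' hv hS
    simp only [MSOForm.qr, max_le_iff] at hm
    simp only [MSOForm.freeFO, MSOForm.freeSO, Finset.mem_union] at hv hS
    exact imp_congr
      (ihφ m hm.1 L f f' hc R hR hR' v v' S S' (fun i hi => hv i (.inl hi))
        fun X hX => hS X (.inl hX))
      (ihψ m hm.2 L f f' hc R hR hR' v v' S S' (fun i hi => hv i (.inr hi))
        fun X hX => hS X (.inr hX))
  | exFO k φ ih =>
    intro m hm L _ f f' hc R hR hR' v v' S S' hv hS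
    obtain ⟨m, rfl⟩ : ∃ m', m = m' + 1 := ⟨m - 1, by simp only [MSOForm.qr] at hm; omega⟩
    have hq : 1 ≤ Nat.card L := have : Nonempty L := ⟨f (rootNode h s)⟩; Nat.card_pos
    have hτ : ∀ h, 1 ≤ threshold (m + 1) (Nat.card L) h := fun h =>
      one_le_two.trans (two_le_threshold _ hq h)
    have hτ' := two_le_threshold m (q := Nat.card L * 2) (by omega)
    have key : ∀ n n', code (threshold m (Nat.card L * 2)) h s (mark f {n}) =
        code (threshold m (Nat.card L * 2)) h s' (mark f' {n'}) →
        ((toStr s lab).Realize φ (Function.update v k n) S ↔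
          (toStr s' lab').Realize φ (Function.update v' k n') S') := by
      intro n n' hn
      refine ih m (by simpa [MSOForm.qr] using hm) (L × Prop) (mark f {n}) (mark f' {n'})
        (by rwa [card_prod_prop])
        (R ∘ Prod.fst) hR hR' _ _ S S' (fun i hi => ?_) (fun X hX => ?_)
      · by_cases hik : i = k
        · subst hik
          exact ⟨Prod.snd,
            fun x => iff_of_eq (congrArg (x = ·) (Function.update_self i n v).symm),
            fun x => iff_of_eq (congrArg (x = ·) (Function.update_self i n' v').symm)⟩
        · obtain ⟨Q, hQ, hQ'⟩ := hv i (Finset.mem_erase.2 ⟨hik, hi⟩)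
          exact ⟨Q ∘ Prod.fst,
            fun x => (hQ x).trans
              (iff_of_eq (congrArg (x = ·) (Function.update_of_ne hik n v).symm)),
            fun x => (hQ' x).trans
              (iff_of_eq (congrArg (x = ·) (Function.update_of_ne hik n' v').symm))⟩
      · obtain ⟨Q, hQ, hQ'⟩ := hS X hX
        exact ⟨Q ∘ Prod.fst, hQ, hQ'⟩
    constructor
    · rintro ⟨n, hn⟩
      obtain ⟨n', hn'⟩ := exists_mark_singleton_code_eq hτ hτ'
        (fun h => (card_code_mul_threshold m h).le) hc n
      exact ⟨n', (key n n' hn').1 hn⟩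
    · rintro ⟨n', hn'⟩
      obtain ⟨n, hn⟩ := exists_mark_singleton_code_eq hτ hτ'
        (fun h => (card_code_mul_threshold m h).le) hc.symm n'
      exact ⟨n, (key n n' hn.symm).2 hn'⟩
  | exSO k φ ih =>
    intro m hm L _ f f' hc R hR hR' v v' S S' hv hS
    obtain ⟨m, rfl⟩ : ∃ m', m = m' + 1 := ⟨m - 1, by simp only [MSOForm.qr] at hm; omega⟩
    have hq : 1 ≤ Nat.card L := have : Nonempty L := ⟨f (rootNode h s)⟩; Nat.card_pos
    have hτ : ∀ h, 1 ≤ threshold (m + 1) (Nat.card L) h := fun h =>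
      one_le_two.trans (two_le_threshold _ hq h)
    have key : ∀ A A', code (threshold m (Nat.card L * 2)) h s (mark f A) =
        code (threshold m (Nat.card L * 2)) h s' (mark f' A') →
        ((toStr s lab).Realize φ v (Function.update S k A) ↔
          (toStr s' lab').Realize φ v' (Function.update S' k A')) := by
      intro A A' hA
      refine ih m (by simpa [MSOForm.qr] using hm) (L × Prop) (mark f A) (mark f' A')
        (by rwa [card_prod_prop])
        (R ∘ Prod.fst) hR hR' v v' _ _ (fun i hi => ?_) (fun X hX => ?_)
      · obtain ⟨Q, hQ, hQ'⟩ := hv i hi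
        exact ⟨Q ∘ Prod.fst, hQ, hQ'⟩
      · by_cases hXk : X = k
        · subst hXk
          exact ⟨Prod.snd,
            fun x => iff_of_eq (congrArg (fun B : Set _ => x ∈ B)
              (Function.update_self X A S).symm),
            fun x => iff_of_eq (congrArg (fun B : Set _ => x ∈ B)
              (Function.update_self X A' S').symm)⟩
        · obtain ⟨Q, hQ, hQ'⟩ := hS X (Finset.mem_erase.2 ⟨hXk, hX⟩)
          exact ⟨Q ∘ Prod.fst,
            fun x => (hQ x).trans (iff_of_eq (congrArg (fun B : Set _ => x ∈ B)
              (Function.update_of_ne hXk A S).symm)),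
            fun x => (hQ' x).trans (iff_of_eq (congrArg (fun B : Set _ => x ∈ B)
              (Function.update_of_ne hXk A' S').symm))⟩
    constructor
    · rintro ⟨A, hA⟩
      obtain ⟨A', hA'⟩ := exists_mark_code_eq hτ
        (fun h => (card_code_mul_threshold m h).le) hc A
      exact ⟨A', (key A A' hA').1 hA⟩
    · rintro ⟨A', hA'⟩
      obtain ⟨A, hA⟩ := exists_mark_code_eq hτ
        (fun h => (card_code_mul_threshold m h).le) hc.symm A'
      exact ⟨A, (key A A' hA.symm).2 hA'⟩

theorem msoEquiv_of_code_eq {p h m : ℕ} {s s' : Shape h} {lab : Node h s → Fin p}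
    {lab' : Node h s' → Fin p}
    (hc : code (threshold m p) h s lab = code (threshold m p) h s' lab') :
    MStr.MSOEquiv m (toStr s lab) (toStr s' lab') := by
  intro φ hφ hm
  have key : ∀ v v' S S', (toStr s lab).Realize φ v S ↔ (toStr s' lab').Realize φ v' S' :=
    fun v v' S S' => realize_iff_of_code_eq φ m hm (Fin p) lab lab' (by rwa [Nat.card_fin]) id
      (fun _ => rfl) (fun _ => rfl) v v' S S' (by simp [hφ.1]) (by simp [hφ.2])
  constructor
  · intro hs v' S'
    exact (key (fun _ => rootNode h s) v' (fun _ => ∅) S').1 (hs _ _)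
  · intro hs v S
    exact (key v (fun _ => rootNode h s') S (fun _ => ∅)).2 (hs _ _)

end Shape

section Isomorphism

namespace MStr

theorem realize_iff_of_equiv {ι : Type*} {M N : MStr ι} (e : M.V ≃ N.V)
    (hE : ∀ a b, M.E a b ↔ N.E (e a) (e b)) (hP : ∀ i a, M.P i a ↔ N.P i (e a))
    (φ : MSOForm ι) (v : ℕ → M.V) (S : ℕ → Set N.V) :
    M.Realize φ v (fun X => e ⁻¹' S X) ↔ N.Realize φ (e ∘ v) S := by
  induction φ generalizing v S with
  | fal => exact Iff.rfl
  | eq i j => exact e.injective.eq_iff.symm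
  | edge i j => exact hE _ _
  | pred a i => exact hP _ _
  | mem i X => exact Iff.rfl
  | imp φ ψ hφ hψ => exact imp_congr (hφ v S) (hψ v S)
  | exFO n φ hφ =>
    refine (e.exists_congr_left (p := fun x => M.Realize φ (Function.update v n x) _)).trans
      (exists_congr fun y => ?_)
    rw [hφ, Function.comp_update, e.apply_symm_apply]
  | exSO X φ hφ =>
    have key : ∀ A : Set N.V, (fun Y => e ⁻¹' Function.update S X A Y) =
        Function.update (fun Y => e ⁻¹' S Y) X (e ⁻¹' A) := fun A =>
      funext fun Y => Function.apply_update (fun _ B => e ⁻¹' B) S X A Y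
    constructor
    · rintro ⟨A, hA⟩
      refine ⟨e '' A, (hφ v _).1 ?_⟩
      rw [key, e.injective.preimage_image]
      exact hA
    · rintro ⟨A, hA⟩
      refine ⟨e ⁻¹' A, ?_⟩
      have := (hφ v _).2 hA
      rwa [key] at this

/-- Isomorphic structures satisfy the same sentences. -/
theorem msoEquiv_of_equiv {ι : Type*} {M N : MStr ι} (e : M.V ≃ N.V)
    (hE : ∀ a b, M.E a b ↔ N.E (e a) (e b)) (hP : ∀ i a, M.P i a ↔ N.P i (e a)) (m : ℕ) :
    MSOEquiv m M N := by
  intro φ _ _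
  constructor
  · intro h v S
    have := (realize_iff_of_equiv e hE hP φ (e.symm ∘ v) S).1 (h _ _)
    rwa [← Function.comp_assoc, e.self_comp_symm, Function.id_comp] at this
  · intro h v S
    have := (realize_iff_of_equiv e hE hP φ v (fun X => e.symm ⁻¹' S X)).2 (h _ _)
    simpa only [← Set.preimage_comp, e.symm_comp_self, Set.preimage_id] using this

end MStr

end Isomorphism

section ShapeOfTree

namespace PTree

variable {p : ℕ} (t : PTree p)

/-- `w` is a child of `v`. -/
def Child (v w : t.V) : Prop :=
  t.g.Adj v w ∧ t.g.dist t.root w = t.g.dist t.root v + 1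

variable {t}

theorem adj_iff_child {v w : t.V} : t.g.Adj v w ↔ t.Child v w ∨ t.Child w v :=
  ⟨fun h => (t.tree.dist_eq_dist_add_one_of_adj t.root h).symm.imp (fun h' => ⟨h, h'⟩)
    (fun h' => ⟨h.symm, h'⟩), fun h => h.elim (fun h => h.1) (fun h => h.1.symm)⟩

theorem Child.parent_unique {v v' w : t.V} (h : t.Child v w) (h' : t.Child v' w) : v = v' := by
  obtain ⟨q, hq, -⟩ := t.tree.existsUnique_path t.root w
  have key : ∀ {u}, t.Child u w → u = q.penultimate := by
    intro u hu
    refine t.tree.isAcyclic.eq_penultimate_of_adj_end hq hu.1.symm ?_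
    obtain ⟨r, hr⟩ := t.tree.connected.exists_walk_length_eq_dist t.root u
    have hrp : (r.concat hu.1).IsPath := by
      apply SimpleGraph.Walk.isPath_of_length_eq_dist
      rw [SimpleGraph.Walk.length_concat, hr, hu.2]
    rw [(t.tree.existsUnique_path t.root w).unique hq hrp]
    simp
  rw [key h, key h']

theorem exists_parent {w : t.V} (hw : w ≠ t.root) : ∃ v, t.Child v w := by
  obtain ⟨r, hr⟩ := t.tree.connected.exists_walk_length_eq_dist w t.root
  cases r with
  | nil => exact absurd rfl hw
  | @cons _ v _ hwv q =>
    rcases t.tree.dist_eq_dist_add_one_of_adj t.root hwv with h | h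
    · exact ⟨v, hwv.symm, h⟩
    · have h1 := SimpleGraph.dist_le q
      rw [SimpleGraph.Walk.length_cons, SimpleGraph.dist_comm] at hr
      rw [SimpleGraph.dist_comm] at h1
      omega

/-- `x` is a descendant of `v`. -/
def Desc (v x : t.V) : Prop := Relation.ReflTransGen t.Child v x

theorem Desc.dist_le {v x : t.V} (h : Desc v x) : t.g.dist t.root v ≤ t.g.dist t.root x := by
  induction h with
  | refl => exact le_rfl
  | tail _ hc ih => exact ih.trans (hc.2 ▸ Nat.le_succ _)

theorem Desc.eq_of_dist_le {v x : t.V} (h : Desc v x)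
    (hd : t.g.dist t.root x ≤ t.g.dist t.root v) : x = v := by
  cases h with
  | refl => rfl
  | tail h hc =>
    have h1 := Desc.dist_le h
    have h2 := hc.2
    omega

theorem Desc.eq_of_dist_eq {v v' x : t.V} (h : Desc v x) (h' : Desc v' x)
    (hd : t.g.dist t.root v = t.g.dist t.root v') : v = v' := by
  induction h with
  | refl => exact h'.eq_of_dist_le hd.le
  | tail h hc ih =>
    cases h' with
    | refl => exact (Desc.eq_of_dist_le (h.tail hc) hd.ge).symm
    | tail h' hc' =>
      obtain rfl := hc.parent_unique hc'
      exact ih h'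

theorem desc_root (x : t.V) : Desc t.root x := by
  by_cases hx : x = t.root
  · exact hx ▸ Relation.ReflTransGen.refl
  · obtain ⟨v, hv⟩ := exists_parent hx
    exact (desc_root v).tail hv
termination_by t.g.dist t.root x
decreasing_by exact hv.2 ▸ Nat.lt_succ_self _

variable (t) in
/-- The shape of the subtree below a node, cut at height `h`. -/
def shapeOf : (h : ℕ) → t.V → Shape h
  | 0, _ => PUnit.unit
  | h + 1, v => ⟨{w // t.Child v w}, fun w => shapeOf h w.1⟩

variable (t) in
/-- The node of `t` corresponding to a node of the shape of a subtree. -/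
def nodeMap : (h : ℕ) → (v : t.V) → Shape.Node h (shapeOf t h v) → t.V
  | 0, v, _ => v
  | _ + 1, v, none => v
  | h + 1, _, some ⟨w, n⟩ => nodeMap h w.1 n

theorem nodeMap_rootNode (h : ℕ) (v : t.V) :
    nodeMap t h v (Shape.rootNode h (shapeOf t h v)) = v := by
  cases h <;> rfl

theorem desc_nodeMap : (h : ℕ) → (v : t.V) → (n : Shape.Node h (shapeOf t h v)) →
    Desc v (nodeMap t h v n)
  | 0, _, _ => Relation.ReflTransGen.refl
  | _ + 1, _, none => Relation.ReflTransGen.refl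
  | h + 1, _, some ⟨w, n⟩ => (desc_nodeMap h w.1 n).head w.2

theorem nodeMap_injective : (h : ℕ) → (v : t.V) → Function.Injective (nodeMap t h v)
  | 0, _, _, _, _ => rfl
  | _ + 1, _, none, none, _ => rfl
  | h + 1, v, none, some ⟨w, n⟩, hab => by
    have h1 := (desc_nodeMap h w.1 n).dist_le
    have h2 := w.2.2
    have h3 : v = nodeMap t h w.1 n := hab
    rw [← h3] at h1
    omega
  | h + 1, v, some ⟨w, n⟩, none, hab => by
    have h1 := (desc_nodeMap h w.1 n).dist_le
    have h2 := w.2.2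
    have h3 : nodeMap t h w.1 n = v := hab
    rw [h3] at h1
    omega
  | h + 1, v, some ⟨w, n⟩, some ⟨w', n'⟩, hab => by
    have h3 : nodeMap t h w.1 n = nodeMap t h w'.1 n' := hab
    have h4 : w = w' := Subtype.ext ((desc_nodeMap h w.1 n).eq_of_dist_eq
      (h3 ▸ desc_nodeMap h w'.1 n') (w.2.2.trans w'.2.2.symm))
    subst h4
    have h5 := nodeMap_injective h w.1 h3
    subst h5
    rfl

theorem exists_nodeMap_eq : (h : ℕ) → (v x : t.V) → Desc v x →
    t.g.dist t.root x ≤ t.g.dist t.root v + h → ∃ n, nodeMap t h v n = x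
  | 0, _, _, hx, hd => ⟨(), (hx.eq_of_dist_le hd).symm⟩
  | h + 1, v, x, hx, hd => by
    rcases Relation.ReflTransGen.cases_head hx with rfl | ⟨w, hw, hwx⟩
    · exact ⟨none, rfl⟩
    · have h2 := hw.2
      obtain ⟨n, hn⟩ := exists_nodeMap_eq h w x hwx (by omega)
      exact ⟨some ⟨⟨w, hw⟩, n⟩, hn⟩

theorem child_nodeMap_iff : (h : ℕ) → (v : t.V) → (a b : Shape.Node h (shapeOf t h v)) →
    (Shape.IsChild h (shapeOf t h v) a b ↔ t.Child (nodeMap t h v a) (nodeMap t h v b))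
  | 0, _, _, _ => ⟨(fun h => nomatch h), fun h => absurd h.1 (SimpleGraph.irrefl _)⟩
  | h + 1, v, a, none => by
    refine ⟨(fun h => nomatch h), fun hc => ?_⟩
    have h1 := (desc_nodeMap (h + 1) v a).dist_le
    have h2 : _ = _ + 1 := hc.2
    change t.g.dist t.root v = _ at h2
    omega
  | h + 1, v, none, some ⟨w, n⟩ => by
    constructor
    · intro hc
      have hn : n = Shape.rootNode h (shapeOf t h w.1) := by
        cases hc with
        | root => rfl
      subst hn
      change t.Child v (nodeMap t h w.1 (Shape.rootNode h (shapeOf t h w.1)))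
      rw [nodeMap_rootNode]
      exact w.2
    · intro hc
      change t.Child v (nodeMap t h w.1 n) at hc
      have hn : nodeMap t h w.1 n = w.1 :=
        (desc_nodeMap h w.1 n).eq_of_dist_le (hc.2.trans w.2.2.symm).le
      have hn' := nodeMap_injective h w.1 (hn.trans (nodeMap_rootNode h w.1).symm)
      subst hn'
      exact Shape.IsChild.root (shapeOf t (h + 1) v) w
  | h + 1, v, some ⟨w, n⟩, some ⟨w', n'⟩ => by
    constructor
    · intro hc
      cases hc with
      | sub _ _ _ _ hc => exact (child_nodeMap_iff h w.1 _ _).1 hc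
    · intro hc
      change t.Child (nodeMap t h w.1 n) (nodeMap t h w'.1 n') at hc
      have hw : w = w' := Subtype.ext (Desc.eq_of_dist_eq ((desc_nodeMap h w.1 n).tail hc)
        (desc_nodeMap h w'.1 n') (w.2.2.trans w'.2.2.symm))
      subst hw
      exact Shape.IsChild.sub (shapeOf t (h + 1) v) w n n' ((child_nodeMap_iff h w.1 n n').2 hc)

theorem nodeMap_bijective {d : ℕ} (ht : t.heightLe d) :
    Function.Bijective (nodeMap t d t.root) :=
  ⟨nodeMap_injective d t.root, fun x =>
    exists_nodeMap_eq d t.root x (desc_root x) ((ht x).trans (Nat.le_add_left _ _))⟩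

/-- A tree of height at most `d` is isomorphic to the tree given by its shape. -/
theorem msoEquiv_shapeOf {d : ℕ} (ht : t.heightLe d) (m : ℕ) :
    MStr.MSOEquiv m (Shape.toStr (shapeOf t d t.root) (t.label ∘ nodeMap t d t.root))
      t.toStr := by
  refine MStr.msoEquiv_of_equiv (M := Shape.toStr _ _) (N := t.toStr)
    (Equiv.ofBijective _ (nodeMap_bijective ht)) (fun a b => ?_) (fun i a => ?_) m
  · exact ((child_nodeMap_iff d t.root a b).or (child_nodeMap_iff d t.root b a)).trans
      adj_iff_child.symm
  · cases i with
    | none =>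
      change a = Shape.rootNode d _ ↔ nodeMap t d t.root a = t.root
      refine (nodeMap_injective d t.root).eq_iff.symm.trans ?_
      rw [nodeMap_rootNode]
    | some j => exact Iff.rfl

end PTree

end ShapeOfTree

section Index

namespace PTree

/-- The index of `≡^MSO_m` is at most the number of codes. -/
theorem mk_quotient_le (d p m : ℕ) :
    Cardinal.mk (Quotient (ptreeSetoid d p m)) ≤ (codeCard (threshold m p) p d : Cardinal) := by
  have hfin := Shape.finite_code (threshold m p) (Fin p) d
  let c : {t : PTree p // t.heightLe d} → Shape.Code (threshold m p) (Fin p) d := fun t =>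
    Shape.code (threshold m p) d (shapeOf t.1 d t.1.root) (t.1.label ∘ nodeMap t.1 d t.1.root)
  have hc : ∀ t t', c t = c t' → MStr.MSOEquiv m t.1.toStr t'.1.toStr := by
    intro t t' h φ h1 h2
    exact ((msoEquiv_shapeOf t.2 m φ h1 h2).symm.trans
      (Shape.msoEquiv_of_code_eq h φ h1 h2)).trans (msoEquiv_shapeOf t'.2 m φ h1 h2)
  have hinj : Function.Injective fun x : Quotient (ptreeSetoid d p m) => c x.out := by
    intro x y hxy
    rw [← x.out_eq, ← y.out_eq]
    exact Quotient.sound (hc _ _ hxy)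
  have h := Cardinal.lift_mk_le_lift_mk_of_injective hinj
  have hcard := Shape.card_code (threshold m p) (Fin p) d
  rw [Nat.card_fin] at hcard
  rw [← Nat.cast_card (α := Shape.Code (threshold m p) (Fin p) d), hcard] at h
  simpa using h

/-- The one-node tree with a given label. -/
def single {p : ℕ} (j : Fin p) : PTree p where
  V := Unit
  g := ⊥
  tree := SimpleGraph.IsTree.of_subsingleton
  root := ()
  label := fun _ => j

theorem heightLe_single {p : ℕ} (j : Fin p) : (single j).heightLe 0 := fun _ =>
  (SimpleGraph.dist_self (G := (single j).g)).le

theorem single_injective {p m : ℕ} (hm : 1 ≤ m) {j j' : Fin p}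
    (h : MStr.MSOEquiv m (single j).toStr (single j').toStr) : j = j' := by
  have key : ∀ i : Fin p,
      (single i).toStr.Sat (.exFO 0 (.pred (some j') 0)) ↔ i = j' := fun i =>
    ⟨fun h => (h (fun _ => ()) (fun _ => ∅)).elim fun _ h => h, fun h _ _ => ⟨(), h⟩⟩
  have h1 := h (.exFO 0 (.pred (some j') 0))
    (by simp [MSOForm.IsSentence, MSOForm.freeFO, MSOForm.freeSO]) (by simpa [MSOForm.qr] using hm)
  rw [key, key] at h1
  exact h1.2 rfl

theorem le_mk_quotient (p : ℕ) {m : ℕ} (hm : 1 ≤ m) :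
    (p : Cardinal) ≤ Cardinal.mk (Quotient (ptreeSetoid 0 p m)) := by
  have hinj : Function.Injective fun j : Fin p =>
      (Quotient.mk (ptreeSetoid 0 p m) ⟨single j, heightLe_single j⟩) := fun _ _ h =>
    single_injective hm (Quotient.exact h)
  simpa using Cardinal.lift_mk_le_lift_mk_of_injective hinj

end PTree

end Index

/-- The index of the `≡^MSO_m` relation over `T_{d,p}` is at most
`ζ_{d,p}(m, d+1)` if `d ≥ 1` and is exactly `p` if `d = 0`. -/
theorem stmt3 (d p : ℕ) :
    ∃ g : ℕ → ℕ, StrictMono g ∧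
      ∀ m : ℕ, 1 ≤ m →
        (1 ≤ d →
          Cardinal.mk (Quotient (ptreeSetoid d p m)) ≤
            ((tower (d + 1) (g d * (m + 1) * (m + Nat.clog 2 p)) : ℕ) : Cardinal)) ∧
        (d = 0 → Cardinal.mk (Quotient (ptreeSetoid d p m)) = (p : Cardinal)) := by
  refine ⟨fun n => 2 * 4 ^ n, fun a b hab => by dsimp only; gcongr; norm_num,
    fun m hm => ⟨fun _ => ?_, ?_⟩⟩
  · refine (PTree.mk_quotient_le d p m).trans (Nat.cast_le.2 ?_)
    refine (codeCard_threshold_le d m p _ (Nat.le_pow_clog one_lt_two p)).trans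
      (tower_mono (d + 1) ?_)
    calc 4 ^ d * ((m + 1) * (m + Nat.clog 2 p + 1))
        ≤ 4 ^ d * ((m + 1) * (2 * (m + Nat.clog 2 p))) := by gcongr; omega
      _ = 2 * 4 ^ d * (m + 1) * (m + Nat.clog 2 p) := by ring
  · rintro rfl
    exact (PTree.mk_quotient_le 0 p m).antisymm (PTree.le_mk_quotient p hm)
end

section
/- Let d, p ∈ ℕ. For every set T of MSO sentences over the vocabulary {E, root, P_1,…,P_p} of p-labeled rooted trees: if every finite subset of T has a model in T_{d,p}, then T has a model in T_{d,p}; moreover, T has an at most countable model in T_{d,p}. -/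
open Cardinal

/-! ### Cardinalities capped at a finite threshold -/

/-- The cardinality of `A` capped at `n`, recorded as the truth values of `j + 1 ≤ |A|`, `j < n`. -/
def capCount {α : Type*} (n : ℕ) (A : Set α) : Fin n → Prop :=
  fun j => (((j : ℕ) + 1 : ℕ) : ℕ∞) ≤ A.encard

theorem capCount_eq_iff {α β : Type*} {n : ℕ} {A : Set α} {B : Set β} :
    capCount n A = capCount n B ↔ min (n : ℕ∞) A.encard = min (n : ℕ∞) B.encard := by
  constructor
  · intro h
    have key : ∀ j : ℕ, j ≤ n → ((j : ℕ∞) ≤ A.encard ↔ (j : ℕ∞) ≤ B.encard) := by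
      intro j hj
      cases j with
      | zero => simp
      | succ j => exact iff_of_eq (congrFun h ⟨j, hj⟩)
    refine ENat.eq_of_forall_natCast_le_iff fun j => ?_
    simp only [le_inf_iff, Nat.cast_le]
    exact and_congr_right (key j)
  · intro h
    funext j
    refine propext ?_
    have h1 : (((j : ℕ) + 1 : ℕ) : ℕ∞) ≤ n := Nat.cast_le.2 j.2
    have : (((j : ℕ) + 1 : ℕ) : ℕ∞) ≤ min (n : ℕ∞) A.encard ↔
        (((j : ℕ) + 1 : ℕ) : ℕ∞) ≤ min (n : ℕ∞) B.encard := by rw [h]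
    simp only [le_inf_iff, h1, true_and] at this
    exact this

theorem nonempty_of_capCount_eq {α β : Type*} {n : ℕ} (hn : 1 ≤ n) {A : Set α} {B : Set β}
    (h : capCount n A = capCount n B) (hA : A.Nonempty) : B.Nonempty := by
  have := congrFun h ⟨0, hn⟩
  simpa [capCount, hA] using this

theorem min_add_eq_of_min_eq {n a b a' b' : ℕ∞} (ha : min n a = min n a')
    (hb : min n b = min n b') : min n (a + b) = min n (a' + b') := by
  rcases le_total n a with h | h
  · have h' : n ≤ a' := by rw [min_eq_left h] at ha; exact ha ▸ min_le_right _ _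
    rw [min_eq_left (h.trans le_self_add), min_eq_left (h'.trans le_self_add)]
  rcases le_total n b with h2 | h2
  · have h' : n ≤ b' := by rw [min_eq_left h2] at hb; exact hb ▸ min_le_right _ _
    rw [min_eq_left (h2.trans le_add_self), min_eq_left (h'.trans le_add_self)]
  rcases le_total n a' with h3 | h3
  · rw [min_eq_right h, min_eq_left h3] at ha
    rw [min_eq_left (ha ▸ le_self_add), min_eq_left (h3.trans le_self_add)]
  rcases le_total n b' with h4 | h4
  · rw [min_eq_right h2, min_eq_left h4] at hb
    rw [min_eq_left (hb ▸ le_add_self), min_eq_left (h4.trans le_add_self)]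
  rw [min_eq_right h, min_eq_right h3] at ha
  rw [min_eq_right h2, min_eq_right h4] at hb
  rw [ha, hb]

theorem min_sum_eq_of_min_eq {κ : Type*} {n : ℕ∞} (s : Finset κ) {x y : κ → ℕ∞}
    (h : ∀ i, min n (x i) = min n (y i)) : min n (∑ i ∈ s, x i) = min n (∑ i ∈ s, y i) := by
  classical
  induction s using Finset.induction_on with
  | empty => rfl
  | insert a s ha ih =>
    rw [Finset.sum_insert ha, Finset.sum_insert ha]
    exact min_add_eq_of_min_eq (h a) ih

theorem encard_eq_sum_fibers {α κ : Type*} [Fintype κ] (A : Set α) (f : α → κ) :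
    A.encard = ∑ i, {a ∈ A | f a = i}.encard := by
  have hA : A = ⋃ i, {a ∈ A | f a = i} := by ext; simp
  conv_lhs => rw [hA]
  rw [Set.encard_iUnion_of_finite, finsum_eq_sum_of_fintype]
  intro i j hij
  refine Set.disjoint_left.2 ?_
  rintro a ⟨_, rfl⟩ ⟨_, h⟩
  exact hij h

/-- Capped cardinalities agree as soon as they agree fibrewise. -/
theorem capCount_eq_of_fibers {α β κ : Type*} [Finite κ] {n : ℕ} {A : Set α} {B : Set β}
    (f : α → κ) (g : β → κ)
    (h : ∀ i, capCount n {a ∈ A | f a = i} = capCount n {b ∈ B | g b = i}) :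
    capCount n A = capCount n B := by
  have := Fintype.ofFinite κ
  rw [capCount_eq_iff, encard_eq_sum_fibers A f, encard_eq_sum_fibers B g]
  exact min_sum_eq_of_min_eq _ fun i => capCount_eq_iff.1 (h i)

/-- If `A` and `B` have the same cardinality up to a large threshold, then a finite colouring of
`A` can be copied to `B` with the same colour counts up to the threshold `n`. -/
theorem exists_capCount_eq {α β κ : Type*} [Nonempty α] [Finite κ] {n m : ℕ}
    (hm : Nat.card κ * n + 1 ≤ m) {A : Set α} {B : Set β} (h : capCount m A = capCount m B)
    (f : α → κ) :
    ∃ g : β → α, Set.MapsTo g B A ∧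
      ∀ i, capCount n {a ∈ A | f a = i} = capCount n {b ∈ B | f (g b) = i} := by
  classical
  have := Fintype.ofFinite κ
  rw [capCount_eq_iff] at h
  rcases lt_or_ge A.encard m with hA | hA
  · have hB : B.encard = A.encard := by
      rw [min_eq_right hA.le] at h
      rcases le_total (m : ℕ∞) B.encard with h' | h'
      · rw [min_eq_left h'] at h; exact absurd h hA.ne
      · rw [min_eq_right h'] at h; exact h.symm
    have hBf : B.Finite := Set.encard_lt_top_iff.1 (hB ▸ hA.trans (ENat.natCast_lt_top m))
    obtain ⟨g, hg⟩ := hBf.exists_bijOn_of_encard_eq hB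
    refine ⟨g, hg.mapsTo, fun i => ?_⟩
    have hi : Set.BijOn g {b ∈ B | f (g b) = i} {a ∈ A | f a = i} := by
      refine ⟨fun b hb => ⟨hg.mapsTo hb.1, hb.2⟩, hg.injOn.mono fun b hb => hb.1, ?_⟩
      rintro a ⟨ha, hai⟩
      obtain ⟨b, hb, rfl⟩ := hg.surjOn ha
      exact ⟨b, ⟨hb, hai⟩, rfl⟩
    rw [capCount_eq_iff, ← hi.image_eq, hi.injOn.encard_image]
  · have hB : (m : ℕ∞) ≤ B.encard := by
      rw [min_eq_left hA] at h; exact h ▸ min_le_right _ _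
    have hm' : (Nat.card κ * n : ℕ∞) < m := by exact_mod_cast hm
    obtain ⟨a₀, ha₀, hn₀⟩ : ∃ a₀ ∈ A, (n : ℕ∞) ≤ {a ∈ A | f a = f a₀}.encard := by
      by_contra! hcon
      have : A.encard ≤ Nat.card κ * n := by
        rw [encard_eq_sum_fibers A f, Nat.card_eq_fintype_card]
        refine (Finset.sum_le_card_nsmul _ _ (n : ℕ∞) fun i _ => ?_).trans_eq
          (by simp [Finset.card_univ])
        rcases Set.eq_empty_or_nonempty {a ∈ A | f a = i} with he | ⟨a, ha, rfl⟩
        · simp [he]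
        · exact (hcon a ha).le
      exact absurd (hA.trans this) hm'.not_ge
    choose F hFsub hFcard using fun i =>
      Set.exists_subset_encard_eq (min_le_right (n : ℕ∞) {a ∈ A | f a = i}.encard)
    have hUfib : ∀ i, {a ∈ ⋃ i, F i | f a = i} = F i := by
      intro i
      ext a
      simp only [Set.mem_iUnion, Set.mem_ofPred_eq]
      constructor
      · rintro ⟨⟨j, hj⟩, rfl⟩
        rwa [(hFsub j hj).2]
      · exact fun ha => ⟨⟨i, ha⟩, (hFsub i ha).2⟩
    have hU : (⋃ i, F i).encard ≤ Nat.card κ * n := by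
      rw [encard_eq_sum_fibers _ f, Nat.card_eq_fintype_card]
      refine (Finset.sum_le_card_nsmul _ _ (n : ℕ∞) fun i _ => ?_).trans_eq
        (by simp [Finset.card_univ])
      rw [hUfib, hFcard]
      exact min_le_left _ _
    obtain ⟨B', hB'B, hB'c⟩ := Set.exists_subset_encard_eq ((hU.trans hm'.le).trans hB)
    have hB'f : B'.Finite := Set.encard_lt_top_iff.1
      (hB'c ▸ (hU.trans_lt (hm'.trans (ENat.natCast_lt_top m))))
    obtain ⟨ι, hι⟩ := hB'f.exists_bijOn_of_encard_eq hB'c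
    have hUA : ∀ a ∈ ⋃ i, F i, a ∈ A := by
      intro a ha
      obtain ⟨i, hi⟩ := Set.mem_iUnion.1 ha
      exact (hFsub i hi).1
    have hfib : ∀ i, {b ∈ B' | f (ι b) = i}.encard = min (n : ℕ∞) {a ∈ A | f a = i}.encard := by
      intro i
      have hi : Set.BijOn ι {b ∈ B' | f (ι b) = i} (F i) := by
        rw [← hUfib i]
        refine ⟨fun b hb => ⟨hι.mapsTo hb.1, hb.2⟩, hι.injOn.mono fun b hb => hb.1, ?_⟩
        rintro a ⟨ha, hai⟩
        obtain ⟨b, hb, rfl⟩ := hι.surjOn ha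
        exact ⟨b, ⟨hb, hai⟩, rfl⟩
      rw [← hFcard, ← hi.image_eq, hi.injOn.encard_image]
    refine ⟨fun b => if b ∈ B' then ι b else a₀, fun b _ => ?_, fun i => ?_⟩
    · dsimp only
      split_ifs with hb
      · exact hUA _ (hι.mapsTo hb)
      · exact ha₀
    · rw [capCount_eq_iff]
      have hsub : {b ∈ B' | f (ι b) = i} ⊆ {b ∈ B | f (if b ∈ B' then ι b else a₀) = i} := by
        rintro b ⟨hb, hbi⟩
        exact ⟨hB'B hb, by rwa [if_pos hb]⟩
      by_cases hi : i = f a₀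
      · have h1 : (n : ℕ∞) ≤ {a ∈ A | f a = i}.encard := hi ▸ hn₀
        have h2 := Set.encard_le_encard hsub
        rw [hfib, min_eq_left h1] at h2
        rw [min_eq_left h1, min_eq_left h2]
      · have : {b ∈ B | f (if b ∈ B' then ι b else a₀) = i} = {b ∈ B' | f (ι b) = i} := by
          refine Set.Subset.antisymm ?_ hsub
          rintro b ⟨hb, hbi⟩
          by_cases hb' : b ∈ B'
          · rw [if_pos hb'] at hbi; exact ⟨hb', hbi⟩
          · rw [if_neg hb'] at hbi; exact absurd hbi.symm hi
        rw [this, hfib, ← min_assoc, min_self]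

/-! ### Rooted trees of bounded height given by a parent function -/

/-- A rooted tree of height at most `d`, presented by its parent function (the root being its own
parent). -/
structure ParentTree (d : ℕ) where
  V : Type
  root : V
  par : V → V
  par_root : par root = root
  iter_par : ∀ v, par^[d] v = root

/-- Hereditary types of vertices of coloured trees: a type of depth `k + 1` records the colour of a
vertex and, for each type of depth `k`, the number of children of that type, capped at `n`. -/
def TreeType (L : Type) (n : ℕ) : ℕ → Type
  | 0 => L
  | k + 1 => L × (TreeType L n k → Fin n → Prop)

instance TreeType.finite {L : Type} [Finite L] {n : ℕ} : ∀ k, Finite (TreeType L n k)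
  | 0 => inferInstanceAs (Finite L)
  | k + 1 =>
    have := TreeType.finite (L := L) (n := n) k
    inferInstanceAs (Finite (L × (TreeType L n k → Fin n → Prop)))

namespace ParentTree

variable {d : ℕ}

instance (t : ParentTree d) : Nonempty t.V := ⟨t.root⟩

/-- The set of children of a vertex. -/
def children (t : ParentTree d) (v : t.V) : Set t.V := {w | w ≠ t.root ∧ t.par w = v}

/-- `t.Level j x` says that `x` is at distance `j` from the root. -/
def Level (t : ParentTree d) : ℕ → t.V → Prop
  | 0, x => x = t.root
  | j + 1, x => x ≠ t.root ∧ t.Level j (t.par x)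

theorem exists_level (t : ParentTree d) (x : t.V) : ∃ j ≤ d, t.Level j x := by
  have key : ∀ m x, t.par^[m] x = t.root → ∃ j ≤ m, t.Level j x := by
    intro m
    induction m with
    | zero => exact fun x hx => ⟨0, le_rfl, hx⟩
    | succ m ih =>
      intro x hx
      by_cases h : x = t.root
      · exact ⟨0, Nat.zero_le _, h⟩
      · obtain ⟨j, hj, hl⟩ := ih (t.par x) hx
        exact ⟨j + 1, Nat.succ_le_succ hj, h, hl⟩
  exact key d x (t.iter_par x)

theorem Level.unique {t : ParentTree d} : ∀ {i j : ℕ} {x : t.V}, t.Level i x → t.Level j x → i = j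
  | 0, 0, _, _, _ => rfl
  | 0, _ + 1, _, h, h' => absurd h h'.1
  | _ + 1, 0, _, h, h' => absurd h' h.1
  | _ + 1, _ + 1, _, h, h' => congrArg Nat.succ (Level.unique h.2 h'.2)

/-- The type of depth `k` of a vertex in a coloured tree. -/
def type (t : ParentTree d) {L : Type} (n : ℕ) (c : t.V → L) : (k : ℕ) → t.V → TreeType L n k
  | 0, v => c v
  | k + 1, v => (c v, fun τ => capCount n {w ∈ t.children v | t.type n c k w = τ})

variable {t t' : ParentTree d} {L M : Type} {n : ℕ}

theorem type_succ_eq_iff {c : t.V → L} {c' : t'.V → L} {k : ℕ} {v : t.V} {v' : t'.V} :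
    t.type n c (k + 1) v = t'.type n c' (k + 1) v' ↔ c v = c' v' ∧
      ∀ τ, capCount n {w ∈ t.children v | t.type n c k w = τ} =
        capCount n {w ∈ t'.children v' | t'.type n c' k w = τ} :=
  Prod.ext_iff.trans (and_congr_right fun _ => funext_iff)

theorem color_eq_of_type_eq {c : t.V → L} {c' : t'.V → L} {k : ℕ} {v : t.V} {v' : t'.V}
    (h : t.type n c k v = t'.type n c' k v') : c v = c' v' := by
  cases k with
  | zero => exact h
  | succ k => exact (type_succ_eq_iff.1 h).1

/-- Equality of types is preserved by relabelling the colours. -/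
theorem type_comp_eq [Finite L] (π : L → M) (k : ℕ) : ∀ {t t' : ParentTree d} {c : t.V → L}
    {c' : t'.V → L} {v : t.V} {v' : t'.V}, t.type n c k v = t'.type n c' k v' →
      t.type n (fun x => π (c x)) k v = t'.type n (fun x => π (c' x)) k v' := by
  induction k with
  | zero => exact fun h => congrArg π h
  | succ k ih =>
    intro t t' c c' v v' h
    rw [type_succ_eq_iff] at h ⊢
    refine ⟨congrArg π h.1, fun τ => ?_⟩
    refine capCount_eq_of_fibers (t.type n c k) (t'.type n c' k) fun κ => ?_
    have hfull : ∀ (s s' : ParentTree d) (e : s.V → L) (e' : s'.V → L) (x : s.V) (v' : s'.V),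
        s.type n e k x = κ → s.type n (fun x => π (e x)) k x = τ →
        {b ∈ {w ∈ s'.children v' | s'.type n (fun x => π (e' x)) k w = τ} |
          s'.type n e' k b = κ} = {w ∈ s'.children v' | s'.type n e' k w = κ} := by
      intro s s' e e' x v' hx hx'
      ext b
      refine ⟨fun hb => ⟨hb.1.1, hb.2⟩, fun hb => ⟨⟨hb.1, ?_⟩, hb.2⟩⟩
      rw [← hx', ih (hb.2.trans hx.symm)]
    by_cases H : ∃ x, t.type n c k x = κ ∧ t.type n (fun x => π (c x)) k x = τ
    · obtain ⟨x, hx, hx'⟩ := H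
      rw [hfull t t c c x v hx hx', hfull t t' c c' x v' hx hx', h.2]
    by_cases H' : ∃ x, t'.type n c' k x = κ ∧ t'.type n (fun x => π (c' x)) k x = τ
    · obtain ⟨x, hx, hx'⟩ := H'
      rw [hfull t' t c' c x v hx hx', hfull t' t' c' c' x v' hx hx', h.2]
    have h1 : {b ∈ {w ∈ t.children v | t.type n (fun x => π (c x)) k w = τ} |
        t.type n c k b = κ} = ∅ :=
      Set.eq_empty_of_forall_notMem fun b hb => H ⟨b, hb.2, hb.1.2⟩
    have h2 : {b ∈ {w ∈ t'.children v' | t'.type n (fun x => π (c' x)) k w = τ} |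
        t'.type n c' k b = κ} = ∅ :=
      Set.eq_empty_of_forall_notMem fun b hb => H' ⟨b, hb.2, hb.1.2⟩
    rw [h1, h2, capCount_eq_iff, Set.encard_empty, Set.encard_empty]

theorem type_eq_of_eq_comp [Finite L] {k : ℕ} {c : t.V → L} {c' : t'.V → L} {e : t.V → M}
    {e' : t'.V → M} {v : t.V} {v' : t'.V} (π : L → M) (he : ∀ x, e x = π (c x))
    (he' : ∀ x, e' x = π (c' x)) (h : t.type n c k v = t'.type n c' k v') :
    t.type n e k v = t'.type n e' k v' := by
  obtain rfl : e = fun x => π (c x) := funext he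
  obtain rfl : e' = fun x => π (c' x) := funext he'
  exact type_comp_eq π k h

theorem exists_level_type_eq (hn : 1 ≤ n) {c : t.V → L} {c' : t'.V → L}
    (h : t.type n c d t.root = t'.type n c' d t'.root) (j : ℕ) : ∀ (k : ℕ) (x : t.V),
      j + k = d → t.Level j x → ∃ x', t'.Level j x' ∧ t.type n c k x = t'.type n c' k x' ∧
        c (t.par x) = c' (t'.par x') := by
  induction j with
  | zero =>
    rintro k x hk rfl
    obtain rfl : k = d := by omega
    refine ⟨t'.root, rfl, h, ?_⟩
    rw [t.par_root, t'.par_root]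
    exact color_eq_of_type_eq h
  | succ j ih =>
    intro k x hjk hx
    obtain ⟨y', hy', hty, -⟩ := ih (k + 1) (t.par x) (by omega) hx.2
    rw [type_succ_eq_iff] at hty
    obtain ⟨x', hx', hxt⟩ :=
      nonempty_of_capCount_eq hn (hty.2 (t.type n c k x)) ⟨x, ⟨hx.1, rfl⟩, rfl⟩
    refine ⟨x', ⟨hx'.1, hx'.2.symm ▸ hy'⟩, hxt.symm, ?_⟩
    rw [hx'.2]
    exact hty.1

/-- Trees of the same type realise the same colours, and the same pairs of colours along edges. -/
theorem exists_color_eq (hn : 1 ≤ n) {c : t.V → L} {c' : t'.V → L}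
    (h : t.type n c d t.root = t'.type n c' d t'.root) (x : t.V) :
    ∃ x', (x' = t'.root ↔ x = t.root) ∧ c x = c' x' ∧ c (t.par x) = c' (t'.par x') := by
  obtain ⟨j, hj, hx⟩ := t.exists_level x
  obtain ⟨x', hx', hxt, hp⟩ := exists_level_type_eq hn h j (d - j) x (by omega) hx
  refine ⟨x', ?_, color_eq_of_type_eq hxt, hp⟩
  cases j with
  | zero => exact iff_of_true hx' hx
  | succ j => exact iff_of_false hx'.1 hx.1

/-- One round of the back-and-forth game with set moves: an extra colouring of `t` can be copied to
a tree which has the same type up to a sufficiently large threshold. -/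
theorem exists_threshold_copy (L M : Type) [Finite L] [Finite M] (d n : ℕ) :
    ∃ N, ∀ n' ≥ N, ∀ {t t' : ParentTree d} {c : t.V → L} {c' : t'.V → L},
      t.type n' c d t.root = t'.type n' c' d t'.root → ∀ e : t.V → M, ∃ e' : t'.V → M,
        t.type n (fun x => (c x, e x)) d t.root = t'.type n (fun x => (c' x, e' x)) d t'.root := by
  refine ⟨(Finset.range d).sup fun k => Nat.card (TreeType (L × M) n k) * n + 1, ?_⟩
  intro n' hn' t t' c c' h e
  have step : ∀ (k : ℕ) (v : t.V) (v' : t'.V), ∃ g : t'.V → t.V, k < d →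
      t.type n' c (k + 1) v = t'.type n' c' (k + 1) v' →
      (∀ w ∈ t'.children v', g w ∈ t.children v ∧ t.type n' c k (g w) = t'.type n' c' k w) ∧
      ∀ τ, capCount n {w ∈ t.children v | t.type n (fun x => (c x, e x)) k w = τ} =
        capCount n {w ∈ t'.children v' | t.type n (fun x => (c x, e x)) k (g w) = τ} := by
    intro k v v'
    by_cases hk : k < d
    swap
    · exact ⟨fun _ => t.root, fun h => absurd h hk⟩
    by_cases hv : t.type n' c (k + 1) v = t'.type n' c' (k + 1) v'
    swap
    · exact ⟨fun _ => t.root, fun _ h => absurd h hv⟩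
    have hm : Nat.card (TreeType (L × M) n k) * n + 1 ≤ n' :=
      le_trans (Finset.le_sup (f := fun k => Nat.card (TreeType (L × M) n k) * n + 1)
        (Finset.mem_range.2 hk)) hn'
    choose g hg hgc using fun σ => exists_capCount_eq hm ((type_succ_eq_iff.1 hv).2 σ)
      (t.type n (fun x => (c x, e x)) k)
    refine ⟨fun w => g (t'.type n' c' k w) w, fun _ _ => ⟨fun w hw => ?_, fun τ => ?_⟩⟩
    · exact hg _ ⟨hw, rfl⟩
    · refine capCount_eq_of_fibers (t.type n' c k) (t'.type n' c' k) fun σ => ?_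
      convert hgc σ τ using 2
      · ext w
        exact and_right_comm
      · ext w
        constructor
        · rintro ⟨⟨h1, h2⟩, rfl⟩
          exact ⟨⟨h1, rfl⟩, h2⟩
        · rintro ⟨⟨h1, rfl⟩, h2⟩
          exact ⟨⟨h1, h2⟩, rfl⟩
  choose G hG using step
  choose lev hlev_le hlev using t'.exists_level
  let m : ℕ → t'.V → t.V := fun j => Nat.rec (fun _ => t.root)
    (fun j r x => G (d - (j + 1)) (r (t'.par x)) (t'.par x) x) j
  have hm : ∀ (j k : ℕ) (x : t'.V), j + k = d → t'.Level j x →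
      t.type n' c k (m j x) = t'.type n' c' k x := by
    intro j
    induction j with
    | zero =>
      rintro k x hk rfl
      obtain rfl : k = d := by omega
      exact h
    | succ j ih =>
      intro k x hk hx
      obtain rfl : k = d - (j + 1) := by omega
      exact ((hG _ _ _ (by omega) (ih (d - (j + 1) + 1) _ (by omega) hx.2)).1 x ⟨hx.1, rfl⟩).2
  have hlev_eq : ∀ {j x}, t'.Level j x → lev x = j := fun hx => (hlev _).unique hx
  have key : ∀ (k j : ℕ) (x : t'.V), j + k = d → t'.Level j x →
      t.type n (fun x => (c x, e x)) k (m j x) =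
        t'.type n (fun x => (c' x, e (m (lev x) x))) k x := by
    intro k
    induction k with
    | zero =>
      intro j x hj hx
      exact Prod.ext (hm j 0 x hj hx) (congrArg (fun i => e (m i x)) (hlev_eq hx).symm)
    | succ k ih =>
      intro j x hj hx
      have hjx := hm j (k + 1) x hj hx
      rw [type_succ_eq_iff]
      refine ⟨Prod.ext (color_eq_of_type_eq hjx) (by rw [hlev_eq hx]), fun τ => ?_⟩
      rw [(hG k _ _ (by omega) hjx).2 τ]
      congr 1
      ext w
      refine and_congr_right fun hw => ?_
      have hwl : t'.Level (j + 1) w := ⟨hw.1, hw.2.symm ▸ hx⟩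
      rw [← ih (j + 1) w (by omega) hwl]
      have hk : d - (j + 1) = k := by omega
      change t.type n _ k (G k (m j x) x w) = τ ↔
        t.type n _ k (G (d - (j + 1)) (m j (t'.par w)) (t'.par w) w) = τ
      rw [hk, hw.2]
  exact ⟨fun x => e (m (lev x) x), key d 0 t'.root (by omega) rfl⟩

/-! ### Types determine monadic second-order properties -/

/-- A vertex-labelled parent tree as a structure over `{E, root, P_1, …, P_p}`. -/
def toStr (t : ParentTree d) {p : ℕ} (lab : t.V → Fin p) : MStr (Option (Fin p)) :=
  ⟨t.V, fun x y => (x ≠ t.root ∧ t.par x = y) ∨ (y ≠ t.root ∧ t.par y = x), fun o v =>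
    match o with
    | none => v = t.root
    | some j => lab v = j⟩

/-- Colours recording the label of a vertex, whether it is the root, and how it relates to the
values of the first `N` variables of both kinds. -/
abbrev AssignColor (p N : ℕ) : Type := (Fin p × Prop) × (Fin N → Prop) × (Fin N → Prop)

/-- The colouring of a labelled tree induced by an assignment. -/
def assignColor (t : ParentTree d) {p : ℕ} (lab : t.V → Fin p) (N : ℕ) (v : ℕ → t.V)
    (s : ℕ → Set t.V) (x : t.V) : AssignColor p N :=
  ((lab x, x = t.root), fun i => v i = x, fun i => x ∈ s i)

section

variable {p N : ℕ} {lab : t.V → Fin p} {lab' : t'.V → Fin p} {v : ℕ → t.V} {v' : ℕ → t'.V}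
  {s : ℕ → Set t.V} {s' : ℕ → Set t'.V} {x : t.V} {x' : t'.V}

theorem value_eq_iff_of_assignColor_eq
    (h : t.assignColor lab N v s x = t'.assignColor lab' N v' s' x')
    {i : ℕ} (hi : i < N) : v i = x ↔ v' i = x' :=
  iff_of_eq (congrFun (congrArg (fun q => q.2.1) h) ⟨i, hi⟩)

theorem mem_iff_of_assignColor_eq (h : t.assignColor lab N v s x = t'.assignColor lab' N v' s' x')
    {i : ℕ} (hi : i < N) : x ∈ s i ↔ x' ∈ s' i :=
  iff_of_eq (congrFun (congrArg (fun q => q.2.2) h) ⟨i, hi⟩)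

theorem label_eq_of_assignColor_eq
    (h : t.assignColor lab N v s x = t'.assignColor lab' N v' s' x') : lab x = lab' x' :=
  congrArg (fun q => q.1.1) h

end

/-- One round of the back-and-forth game with point moves. -/
theorem exists_threshold_copy_point (L : Type) [Finite L] (d n : ℕ) :
    ∃ m ≥ n, ∃ N, ∀ n' ≥ N, ∀ {t t' : ParentTree d} {c : t.V → L} {c' : t'.V → L},
      t.type n' c d t.root = t'.type n' c' d t'.root → ∀ x : t.V, ∃ x' : t'.V,
        t.type m (fun y => (c y, x = y)) d t.root =
          t'.type m (fun y => (c' y, x' = y)) d t'.root := by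
  obtain ⟨N₁, hN₁⟩ := exists_threshold_copy (L × Prop) Prop d 1
  obtain ⟨N, hN⟩ := exists_threshold_copy L Prop d (max (max N₁ n) 1)
  refine ⟨max (max N₁ n) 1, by omega, N, fun n' hn' t t' c c' h x => ?_⟩
  obtain ⟨e, he⟩ := hN n' hn' h fun y => x = y
  obtain ⟨x', -, hx', -⟩ := exists_color_eq (by omega) he x
  have hex : e x' := (congrArg Prod.snd hx').mp rfl
  suffices e = fun y => x' = y by subst this; exact ⟨x', he⟩
  funext y
  refine propext ⟨fun hy => ?_, fun hy => hy ▸ hex⟩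
  obtain ⟨f, hf⟩ := hN₁ _ (by omega) he.symm fun z => x' = z
  obtain ⟨a, -, ha, -⟩ := exists_color_eq le_rfl hf x'
  obtain ⟨b, -, hb, -⟩ := exists_color_eq le_rfl hf y
  have hxa : x = a := (congrArg (fun q => q.1.2) ha).mp hex
  have hxb : x = b := (congrArg (fun q => q.1.2) hb).mp hy
  have hfa : f a := (congrArg (fun q => q.2) ha).mp rfl
  exact (congrArg (fun q => q.2) hb).mpr (hxb ▸ hxa ▸ hfa)

/-- Over trees of height at most `d`, every formula is decided by types with a sufficiently large
threshold. -/
theorem exists_threshold_realize_iff (d p : ℕ) (φ : MSOForm (Option (Fin p))) :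
    ∃ N₀, ∀ N ≥ N₀, ∃ n₀, ∀ n ≥ n₀, ∀ (t t' : ParentTree d) (lab : t.V → Fin p)
      (lab' : t'.V → Fin p) (v : ℕ → t.V) (v' : ℕ → t'.V) (s : ℕ → Set t.V) (s' : ℕ → Set t'.V),
      t.type n (t.assignColor lab N v s) d t.root =
        t'.type n (t'.assignColor lab' N v' s') d t'.root →
      (t.toStr lab).Realize φ v s → (t'.toStr lab').Realize φ v' s' := by
  induction φ with
  | fal => exact ⟨0, fun N _ => ⟨0, fun _ _ _ _ _ _ _ _ _ _ _ h => h⟩⟩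
  | eq i j =>
    refine ⟨max i j + 1, fun N hN => ⟨1, fun n hn t t' lab lab' v v' s s' h hr => ?_⟩⟩
    obtain ⟨x', -, hx, -⟩ := exists_color_eq hn h (v i)
    exact ((value_eq_iff_of_assignColor_eq hx (by omega)).1 rfl).trans
      ((value_eq_iff_of_assignColor_eq hx (by omega)).1 hr.symm).symm
  | edge i j =>
    refine ⟨max i j + 1, fun N hN => ⟨1, fun n hn t t' lab lab' v v' s s' h hr => ?_⟩⟩
    have aux : ∀ i < N, ∀ j < N, v i ≠ t.root ∧ t.par (v i) = v j →
        v' i ≠ t'.root ∧ t'.par (v' i) = v' j := by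
      intro i hi j hj hij
      obtain ⟨x', hroot, hx, hp⟩ := exists_color_eq hn h (v i)
      have h1 : v' i = x' := (value_eq_iff_of_assignColor_eq hx hi).1 rfl
      have h2 : v' j = t'.par x' := (value_eq_iff_of_assignColor_eq hp hj).1 hij.2.symm
      rw [h1, h2]
      exact ⟨fun h' => hij.1 (hroot.1 h'), rfl⟩
    exact hr.imp (aux i (by omega) j (by omega)) (aux j (by omega) i (by omega))
  | pred a i =>
    refine ⟨i + 1, fun N hN => ⟨1, fun n hn t t' lab lab' v v' s s' h hr => ?_⟩⟩
    obtain ⟨x', hroot, hx, -⟩ := exists_color_eq hn h (v i)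
    have h1 : v' i = x' := (value_eq_iff_of_assignColor_eq hx (by omega)).1 rfl
    cases a with
    | none => exact h1.trans (hroot.2 hr)
    | some a => exact (congrArg lab' h1).trans ((label_eq_of_assignColor_eq hx).symm.trans hr)
  | mem i X =>
    refine ⟨max i X + 1, fun N hN => ⟨1, fun n hn t t' lab lab' v v' s s' h hr => ?_⟩⟩
    obtain ⟨x', -, hx, -⟩ := exists_color_eq hn h (v i)
    have h1 : v' i = x' := (value_eq_iff_of_assignColor_eq hx (by omega)).1 rfl
    change v' i ∈ s' X
    rw [h1]
    exact (mem_iff_of_assignColor_eq hx (by omega)).1 hr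
  | imp φ ψ ihφ ihψ =>
    obtain ⟨N₁, h₁⟩ := ihφ
    obtain ⟨N₂, h₂⟩ := ihψ
    refine ⟨max N₁ N₂, fun N hN => ?_⟩
    obtain ⟨n₁, h₁⟩ := h₁ N (by omega)
    obtain ⟨n₂, h₂⟩ := h₂ N (by omega)
    refine ⟨max n₁ n₂, fun n hn t t' lab lab' v v' s s' h hr hφ => ?_⟩
    exact h₂ n (by omega) t t' lab lab' v v' s s' h
      (hr (h₁ n (by omega) t' t lab' lab v' v s' s h.symm hφ))
  | exFO i φ ih =>
    obtain ⟨N₀, h₀⟩ := ih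
    refine ⟨N₀, fun N hN => ?_⟩
    obtain ⟨n₀, h₀⟩ := h₀ N hN
    obtain ⟨m, hm, n₁, h₁⟩ := exists_threshold_copy_point (AssignColor p N) d n₀
    refine ⟨n₁, fun n hn t t' lab lab' v v' s s' h ⟨x, hx⟩ => ?_⟩
    obtain ⟨x', hx'⟩ := h₁ n hn h x
    refine ⟨x', h₀ m hm t t' lab lab' _ _ s s' ?_ hx⟩
    let π : AssignColor p N × Prop → AssignColor p N := fun q =>
      (q.1.1, fun j => if (j : ℕ) = i then q.2 else q.1.2.1 j, q.1.2.2)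
    have hupd : ∀ (t : ParentTree d) (lab : t.V → Fin p) (v : ℕ → t.V) (s : ℕ → Set t.V)
        (x y : t.V),
        t.assignColor lab N (Function.update v i x) s y = π (t.assignColor lab N v s y, x = y) := by
      intro t lab v s x y
      refine Prod.ext rfl (Prod.ext (funext fun j => ?_) rfl)
      by_cases hj : (j : ℕ) = i <;> simp [assignColor, π, Function.update_apply, hj]
    exact type_eq_of_eq_comp π (hupd t lab v s x) (hupd t' lab' v' s' x') hx'
  | exSO X φ ih =>
    obtain ⟨N₀, h₀⟩ := ih
    refine ⟨N₀, fun N hN => ?_⟩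
    obtain ⟨n₀, h₀⟩ := h₀ N hN
    obtain ⟨n₁, h₁⟩ := exists_threshold_copy (AssignColor p N) Prop d n₀
    refine ⟨n₁, fun n hn t t' lab lab' v v' s s' h ⟨A, hA⟩ => ?_⟩
    obtain ⟨A', hA'⟩ := h₁ n hn h (fun y => y ∈ A)
    refine ⟨{y | A' y}, h₀ n₀ le_rfl t t' lab lab' v v' _ _ ?_ hA⟩
    let π : AssignColor p N × Prop → AssignColor p N := fun q =>
      (q.1.1, q.1.2.1, fun j => if (j : ℕ) = X then q.2 else q.1.2.2 j)
    have hupd : ∀ (t : ParentTree d) (lab : t.V → Fin p) (v : ℕ → t.V) (s : ℕ → Set t.V)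
        (A : Set t.V) (y : t.V), t.assignColor lab N v (Function.update s X A) y =
          π (t.assignColor lab N v s y, y ∈ A) := by
      intro t lab v s A y
      refine Prod.ext rfl (Prod.ext rfl (funext fun j => ?_))
      by_cases hj : (j : ℕ) = X <;> simp [assignColor, π, Function.update_apply, hj]
    exact type_eq_of_eq_comp π (hupd t lab v s A) (hupd t' lab' v' s' _) hA'

/-- Trees with the same sufficiently fine type satisfy `φ` under the assignments sending all
variables to the root and to the empty set, respectively. -/
theorem exists_threshold_realize_root (d p : ℕ) (φ : MSOForm (Option (Fin p))) :
    ∃ n, ∀ (t t' : ParentTree d) (lab : t.V → Fin p) (lab' : t'.V → Fin p),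
      t.type n (fun x => (lab x, x = t.root)) d t.root =
        t'.type n (fun x => (lab' x, x = t'.root)) d t'.root →
      (t.toStr lab).Realize φ (fun _ => t.root) (fun _ => ∅) →
      (t'.toStr lab').Realize φ (fun _ => t'.root) (fun _ => ∅) := by
  obtain ⟨N, hN⟩ := exists_threshold_realize_iff d p φ
  obtain ⟨n, hn⟩ := hN N le_rfl
  refine ⟨n, fun t t' lab lab' h => hn n le_rfl t t' lab lab' _ _ _ _ ?_⟩
  let π : Fin p × Prop → AssignColor p N := fun q => (q, fun _ => q.2, fun _ => False)
  have hcol : ∀ (t : ParentTree d) (lab : t.V → Fin p) (y : t.V),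
      t.assignColor lab N (fun _ => t.root) (fun _ => ∅) y = π (lab y, y = t.root) := by
    intro t lab y
    simp [assignColor, π, eq_comm]
  exact type_eq_of_eq_comp π (hcol t lab) (hcol t' lab') h

end ParentTree

/-- Satisfaction only depends on the values of the free variables. -/
theorem MStr.realize_congr {ι : Type*} (M : MStr ι) (φ : MSOForm ι) :
    ∀ {v v' : ℕ → M.V} {s s' : ℕ → Set M.V}, (∀ i ∈ φ.freeFO, v i = v' i) →
      (∀ i ∈ φ.freeSO, s i = s' i) → (M.Realize φ v s ↔ M.Realize φ v' s') := by
  induction φ with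
  | fal => exact fun _ _ => Iff.rfl
  | eq i j => intro v v' s s' h _; simp_all [MStr.Realize, MSOForm.freeFO]
  | edge i j => intro v v' s s' h _; simp_all [MStr.Realize, MSOForm.freeFO]
  | pred a i => intro v v' s s' h _; simp_all [MStr.Realize, MSOForm.freeFO]
  | mem i X =>
    intro v v' s s' h h'
    simp_all [MStr.Realize, MSOForm.freeFO, MSOForm.freeSO]
  | imp φ ψ ihφ ihψ =>
    intro v v' s s' h h'
    simp only [MSOForm.freeFO, MSOForm.freeSO, Finset.mem_union] at h h'
    exact imp_congr (ihφ (fun i hi => h i (.inl hi)) fun i hi => h' i (.inl hi))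
      (ihψ (fun i hi => h i (.inr hi)) fun i hi => h' i (.inr hi))
  | exFO n φ ih =>
    intro v v' s s' h h'
    refine exists_congr fun x => ih (fun i hi => ?_) h'
    by_cases hin : i = n
    · simp [hin]
    · simp [hin, h i (Finset.mem_erase.2 ⟨hin, hi⟩)]
  | exSO n φ ih =>
    intro v v' s s' h h'
    refine exists_congr fun x => ih h (fun i hi => ?_)
    by_cases hin : i = n
    · simp [hin]
    · simp [hin, h' i (Finset.mem_erase.2 ⟨hin, hi⟩)]

theorem MStr.sat_iff_realize {ι : Type*} (M : MStr ι) {φ : MSOForm ι} (hφ : φ.IsSentence)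
    (v : ℕ → M.V) (s : ℕ → Set M.V) : M.Sat φ ↔ M.Realize φ v s :=
  ⟨fun h => h v s, fun h _ _ => (M.realize_congr φ (by simp [hφ.1]) (by simp [hφ.2])).1 h⟩

theorem natCast_le_encard_iff {α : Type*} {m : ℕ} {S : Set α} :
    (m : ℕ∞) ≤ S.encard ↔ ∃ g : Fin m → α, g.Injective ∧ ∀ a, g a ∈ S := by
  constructor
  · intro h
    obtain ⟨A, hAS, hA⟩ := Set.exists_subset_encard_eq h
    have hfin : A.Finite := Set.finite_of_encard_eq_coe hA
    have := hfin.to_subtype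
    have hcard : Nat.card A = m := by
      rw [Nat.card_coe_set_eq, Set.ncard, hA, ENat.toNat_natCast]
    let e := Finite.equivFinOfCardEq hcard
    exact ⟨fun a => (e.symm a : α), Subtype.val_injective.comp e.symm.injective,
      fun a => hAS (e.symm a).2⟩
  · rintro ⟨g, hg, hS⟩
    calc (m : ℕ∞) = (Set.range g).encard := by rw [← Set.image_univ, hg.encard_image]; simp
      _ ≤ S.encard := Set.encard_le_encard (Set.range_subset_iff.2 hS)

namespace ParentTree

variable {d : ℕ} {I : Type} {L : Type} {n : ℕ}

section Ultraproduct

variable (U : Ultrafilter I) (F : I → ParentTree d)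

/-- The element of an ultraproduct represented by a family of elements. -/
def ultraMk (x : ∀ i, (F i).V) : (U : Filter I).Product fun i => (F i).V :=
  Quotient.mk (Filter.productSetoid (U : Filter I) fun i => (F i).V) x

variable {F} in
theorem ultraMk_eq_iff {x y : ∀ i, (F i).V} :
    ultraMk U F x = ultraMk U F y ↔ ∀ᶠ i in U, x i = y i :=
  Quotient.eq

theorem ultraMk_surjective : Function.Surjective (ultraMk U F) := Quotient.mk_surjective

/-- The parent function of an ultraproduct. -/
def ultraPar :
    ((U : Filter I).Product fun i => (F i).V) → (U : Filter I).Product fun i => (F i).V :=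
  Quotient.map (fun x i => (F i).par (x i)) fun _ _ h =>
    Filter.Eventually.mono h fun i hi => congrArg (F i).par hi

theorem iterate_ultraPar (m : ℕ) : ∀ x : ∀ i, (F i).V,
    (ultraPar U F)^[m] (ultraMk U F x) = ultraMk U F fun i => (F i).par^[m] (x i) := by
  induction m with
  | zero => exact fun _ => rfl
  | succ m ih => exact fun x => ih fun i => (F i).par (x i)

/-- The ultraproduct of a family of trees of height at most `d`. -/
def ultraproduct : ParentTree d where
  V := (U : Filter I).Product fun i => (F i).V
  root := ultraMk U F fun i => (F i).root
  par := ultraPar U F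
  par_root := congrArg (ultraMk U F) (funext fun i => (F i).par_root)
  iter_par v := by
    obtain ⟨x, rfl⟩ := ultraMk_surjective U F v
    rw [iterate_ultraPar]
    exact congrArg _ (funext fun i => (F i).iter_par (x i))

variable {F}

theorem ultraMk_mem_children_iff {x y : ∀ i, (F i).V} :
    ultraMk U F y ∈ (ultraproduct U F).children (ultraMk U F x) ↔
      ∀ᶠ i in U, y i ∈ (F i).children (x i) := by
  refine Iff.trans (and_congr ?_ ?_) Filter.eventually_and.symm
  · exact (not_congr (ultraMk_eq_iff U)).trans Ultrafilter.eventually_not.symm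
  · exact ultraMk_eq_iff U (x := fun i => (F i).par (y i))

theorem natCast_le_encard_iff_eventually {S : ∀ i, Set (F i).V} {S' : Set (ultraproduct U F).V}
    (h : ∀ x, ultraMk U F x ∈ S' ↔ ∀ᶠ i in U, x i ∈ S i) (m : ℕ) :
    (m : ℕ∞) ≤ S'.encard ↔ ∀ᶠ i in U, (m : ℕ∞) ≤ (S i).encard := by
  simp only [natCast_le_encard_iff]
  constructor
  · rintro ⟨g, hg, hS⟩
    choose x hx using fun a => ultraMk_surjective U F (g a)
    have h1 : ∀ᶠ i in U, ∀ a, x a i ∈ S i :=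
      Filter.eventually_all.2 fun a => (h (x a)).1 (by rw [hx]; exact hS a)
    have h2 : ∀ᶠ i in U, ∀ a b, a ≠ b → x a i ≠ x b i := by
      refine Filter.eventually_all.2 fun a => Filter.eventually_all.2 fun b => ?_
      by_cases hab : a = b
      · exact .of_forall fun _ hne => absurd hab hne
      · refine (Ultrafilter.eventually_not.2 fun he => hab (hg ?_)).mono fun _ hi _ => hi
        rw [← hx, ← hx]
        exact (ultraMk_eq_iff U).2 he
    filter_upwards [h1, h2] with i h1 h2
    exact ⟨fun a => x a i, fun a b hab => by_contra fun hne => h2 a b hne hab, h1⟩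
  · intro hev
    have : ∀ i, ∃ g : Fin m → (F i).V, (∃ g : Fin m → (F i).V, g.Injective ∧ ∀ a, g a ∈ S i) →
        g.Injective ∧ ∀ a, g a ∈ S i := by
      intro i
      by_cases H : ∃ g : Fin m → (F i).V, g.Injective ∧ ∀ a, g a ∈ S i
      · exact ⟨H.choose, fun _ => H.choose_spec⟩
      · exact ⟨fun _ => (F i).root, fun h => absurd h H⟩
    choose g hg using this
    refine ⟨fun a => ultraMk U F fun i => g i a, fun a b hab => ?_, fun a => ?_⟩
    · obtain ⟨i, hi, hi'⟩ := (((ultraMk_eq_iff U).1 hab).and hev).exists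
      exact (hg i hi').1 hi
    · exact (h _).2 (hev.mono fun i hi => (hg i hi).2 a)

theorem exists_eventually_eq [Finite L] (f : I → L) : ∃ l, ∀ᶠ i in U, f i = l := by
  by_contra! H
  obtain ⟨i, hi⟩ := (Filter.eventually_all.2 H).exists
  exact hi (f i) rfl

theorem exists_limit_color [Finite L] (c : ∀ i, (F i).V → L) :
    ∃ c' : (ultraproduct U F).V → L, ∀ x l,
      (∀ᶠ i in U, c i (x i) = l) → c' (ultraMk U F x) = l := by
  choose r hr using ultraMk_surjective U F
  choose c' hc' using fun q => exists_eventually_eq U fun i => c i (r q i)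
  refine ⟨c', fun x l hl => ?_⟩
  obtain ⟨i, h1, h2, h3⟩ :=
    (((ultraMk_eq_iff U).1 (hr (ultraMk U F x))).and (hl.and (hc' (ultraMk U F x)))).exists
  rw [← h3, ← h2, h1]

theorem type_ultraMk [Finite L] {c : ∀ i, (F i).V → L} {c' : (ultraproduct U F).V → L}
    (hc : ∀ x l, (∀ᶠ i in U, c i (x i) = l) → c' (ultraMk U F x) = l) (k : ℕ) :
    ∀ x τ, (∀ᶠ i in U, (F i).type n (c i) k (x i) = τ) →
      (ultraproduct U F).type n c' k (ultraMk U F x) = τ := by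
  induction k with
  | zero => exact hc
  | succ k ih =>
    rintro x ⟨l, f⟩ h
    refine Prod.ext (hc x l (h.mono fun i hi => congrArg Prod.fst hi))
      (funext fun τ => funext fun j => propext ?_)
    have hS : ∀ y, ultraMk U F y ∈ {w ∈ (ultraproduct U F).children (ultraMk U F x) |
          (ultraproduct U F).type n c' k w = τ} ↔
        ∀ᶠ i in U, y i ∈ {w ∈ (F i).children (x i) | (F i).type n (c i) k w = τ} := by
      intro y
      refine Iff.trans (and_congr (ultraMk_mem_children_iff U) ⟨fun hτ => ?_, ih y τ⟩)
        Filter.eventually_and.symm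
      obtain ⟨σ, hσ⟩ := exists_eventually_eq U fun i => (F i).type n (c i) k (y i)
      rwa [← hτ, ih y σ hσ]
    refine (natCast_le_encard_iff_eventually U hS _).trans ?_
    have hf : ∀ᶠ i in U, (((((j : ℕ) + 1 : ℕ) : ℕ∞) ≤
        {w ∈ (F i).children (x i) | (F i).type n (c i) k w = τ}.encard) ↔ f τ j) :=
      h.mono fun i hi => iff_of_eq (congrFun (congrFun (congrArg Prod.snd hi) τ) j)
    rw [Filter.eventually_congr hf]
    exact Filter.eventually_const

end Ultraproduct

section Subtree

/-- The subtree on a set of vertices that contains the root and is closed under parents. -/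
def subtree (t : ParentTree d) (S : Set t.V) (hroot : t.root ∈ S) (hpar : ∀ v ∈ S, t.par v ∈ S) :
    ParentTree d where
  V := S
  root := ⟨t.root, hroot⟩
  par v := ⟨t.par v, hpar v v.2⟩
  par_root := Subtype.ext t.par_root
  iter_par v := by
    have key : ∀ m (v : S), (((fun v : S => (⟨t.par v, hpar v v.2⟩ : S))^[m] v : S) : t.V) =
        t.par^[m] v := by
      intro m
      induction m with
      | zero => exact fun _ => rfl
      | succ m ih => exact fun v => ih ⟨t.par v, hpar v v.2⟩
    exact Subtype.ext ((key d v).trans (t.iter_par v))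

/-- Types are preserved in a subtree containing, for every vertex, enough children of each type. -/
theorem type_subtree {t : ParentTree d} (c : t.V → L) {S : Set t.V} (hroot : t.root ∈ S)
    (hpar : ∀ v ∈ S, t.par v ∈ S)
    (hS : ∀ v ∈ S, ∀ k τ, min (n : ℕ∞) {w ∈ t.children v | t.type n c k w = τ}.encard ≤
      ({w ∈ t.children v | t.type n c k w = τ} ∩ S).encard) (k : ℕ) :
    ∀ v : S, (t.subtree S hroot hpar).type n (fun w => c w.1) k v = t.type n c k v.1 := by
  induction k with
  | zero => exact fun _ => rfl
  | succ k ih =>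
    intro v
    refine type_succ_eq_iff.2 ⟨rfl, fun τ => capCount_eq_iff.2 ?_⟩
    have himage : Subtype.val '' {w : S | w ∈ (t.subtree S hroot hpar).children v ∧
        (t.subtree S hroot hpar).type n (fun w => c w.1) k w = τ} =
        {w ∈ t.children v.1 | t.type n c k w = τ} ∩ S := by
      ext w
      constructor
      · rintro ⟨w, ⟨⟨h1, h2⟩, h3⟩, rfl⟩
        refine ⟨⟨⟨fun h => h1 (Subtype.ext h), congrArg Subtype.val h2⟩, ?_⟩, w.2⟩
        rw [← ih, h3]
      · rintro ⟨⟨⟨h1, h2⟩, h3⟩, hw⟩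
        refine ⟨⟨w, hw⟩, ⟨⟨fun h => h1 (congrArg Subtype.val h), Subtype.ext h2⟩, ?_⟩, rfl⟩
        rw [ih, h3]
    have hcard := (Subtype.val_injective (p := (· ∈ S))).encard_image {w : S |
      w ∈ (t.subtree S hroot hpar).children v ∧
        (t.subtree S hroot hpar).type n (fun w => c w.1) k w = τ}
    rw [himage] at hcard
    refine (congrArg (min (n : ℕ∞)) hcard.symm).trans (le_antisymm ?_ ?_)
    · exact min_le_min_left _ (Set.encard_le_encard Set.inter_subset_left)
    · exact le_min (min_le_left _ _) (hS v.1 v.2 k τ)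

/-- A Löwenheim–Skolem property: every coloured tree has a countable subtree preserving types. -/
theorem exists_countable_subtree [Finite L] (t : ParentTree d) (c : t.V → L) :
    ∃ (S : Set t.V) (hroot : t.root ∈ S) (hpar : ∀ v ∈ S, t.par v ∈ S), S.Countable ∧
      ∀ n k, ∀ v : S, (t.subtree S hroot hpar).type n (fun w => c w.1) k v = t.type n c k v.1 := by
  have hW : ∀ n k v τ, ∃ W ⊆ {w ∈ t.children v | t.type n c k w = τ},
      W.encard = min (n : ℕ∞) {w ∈ t.children v | t.type n c k w = τ}.encard := fun n k v τ =>
    Set.exists_subset_encard_eq (min_le_right _ _)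
  choose W hWsub hWcard using hW
  let A : ℕ → Set t.V := fun j => Nat.rec {t.root} (fun _ B => ⋃ v ∈ B, ⋃ n, ⋃ k, ⋃ τ, W n k v τ) j
  have hA : ∀ j, (A j).Countable := by
    intro j
    induction j with
    | zero => exact Set.countable_singleton _
    | succ j ih =>
      refine ih.biUnion fun v _ => Set.countable_iUnion fun n => Set.countable_iUnion fun k =>
        Set.countable_iUnion fun τ => Set.Finite.countable ?_
      rw [← Set.encard_lt_top_iff, hWcard]
      exact (min_le_left _ _).trans_lt (ENat.natCast_lt_top n)
  refine ⟨⋃ j, A j, Set.mem_iUnion.2 ⟨0, rfl⟩, fun v hv => ?_, Set.countable_iUnion hA,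
    fun n => type_subtree c _ _ fun v hv k τ => ?_⟩
  · obtain ⟨j, hj⟩ := Set.mem_iUnion.1 hv
    cases j with
    | zero =>
      obtain rfl : v = t.root := hj
      exact Set.mem_iUnion.2 ⟨0, t.par_root⟩
    | succ j =>
      obtain ⟨u, hu, hv⟩ := Set.mem_iUnion₂.1 (show v ∈ ⋃ u ∈ A j, ⋃ n, ⋃ k, ⋃ τ, W n k u τ from hj)
      simp only [Set.mem_iUnion] at hv
      obtain ⟨n, k, τ, hv⟩ := hv
      rw [(hWsub n k u τ hv).1.2]
      exact Set.mem_iUnion.2 ⟨j, hu⟩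
  · obtain ⟨j, hj⟩ := Set.mem_iUnion.1 hv
    rw [← hWcard]
    refine Set.encard_le_encard fun w hw => ⟨hWsub n k v τ hw, Set.mem_iUnion.2 ⟨j + 1, ?_⟩⟩
    refine Set.mem_iUnion₂.2 ⟨v, hj, ?_⟩
    simp only [Set.mem_iUnion]
    exact ⟨n, k, τ, hw⟩

end Subtree

section PTree

variable {p : ℕ}

theorem eq_root_of_iterate_par_eq (t : ParentTree d) {x : t.V} {m : ℕ}
    (h : t.par^[m] (t.par x) = x) : x = t.root := by
  have hx : Function.IsPeriodicPt t.par (m + 1) x := h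
  have := hx.const_mul d
  rw [Function.IsPeriodicPt, Function.IsFixedPt, Nat.mul_succ, Function.iterate_add_apply,
    t.iter_par, Function.iterate_fixed t.par_root] at this
  exact this.symm

/-- The graph whose edges join vertices to their parents. -/
def graph (t : ParentTree d) : SimpleGraph t.V where
  Adj x y := (x ≠ t.root ∧ t.par x = y) ∨ (y ≠ t.root ∧ t.par y = x)
  symm := ⟨fun _ _ => Or.symm⟩
  loopless := ⟨fun _ h => h.elim (fun h => h.1 (t.eq_root_of_iterate_par_eq (m := 0) h.2))
    fun h => h.1 (t.eq_root_of_iterate_par_eq (m := 0) h.2)⟩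

theorem exists_walk_length_le (t : ParentTree d) (m : ℕ) :
    ∀ v, t.par^[m] v = t.root → ∃ q : t.graph.Walk t.root v, q.length ≤ m := by
  induction m with
  | zero =>
    rintro v rfl
    exact ⟨.nil, le_rfl⟩
  | succ m ih =>
    intro v hv
    by_cases h : v = t.root
    · subst h
      exact ⟨.nil, Nat.zero_le _⟩
    · obtain ⟨q, hq⟩ := ih _ hv
      refine ⟨q.concat (show t.graph.Adj (t.par v) v from .inr ⟨h, rfl⟩), ?_⟩
      rw [SimpleGraph.Walk.length_concat]
      exact Nat.succ_le_succ hq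

theorem isBridge_graph (t : ParentTree d) {x : t.V} (hx : x ≠ t.root) :
    t.graph.IsBridge s(x, t.par x) := by
  rw [SimpleGraph.isBridge_iff]
  rintro ⟨q⟩
  have key : ∀ {a b : t.V}, (t.graph.deleteEdges {s(x, t.par x)}).Walk a b →
      (∃ m, t.par^[m] a = x) → ∃ m, t.par^[m] b = x := by
    intro a b q
    induction q with
    | nil => exact id
    | cons hadj _ ih =>
      rintro ⟨m, hm⟩
      rw [SimpleGraph.deleteEdges_adj] at hadj
      obtain ⟨h | h, hne⟩ := hadj
      · cases m with
        | zero =>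
          obtain rfl : _ = x := hm
          exact absurd (congrArg (fun z => s(_, z)) h.2.symm) hne
        | succ m => exact ih ⟨m, by rw [← h.2]; exact hm⟩
      · exact ih ⟨m + 1, by rw [Function.iterate_succ_apply, h.2, hm]⟩
  obtain ⟨m, hm⟩ := key q ⟨0, rfl⟩
  exact hx (t.eq_root_of_iterate_par_eq hm)

theorem isTree_graph (t : ParentTree d) : t.graph.IsTree where
  connected := t.graph.connected_iff_exists_forall_reachable.2
    ⟨t.root, fun v => let ⟨q, _⟩ := t.exists_walk_length_le d v (t.iter_par v); ⟨q⟩⟩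
  isAcyclic := by
    rw [SimpleGraph.isAcyclic_iff_forall_adj_isBridge]
    rintro x y (⟨hx, rfl⟩ | ⟨hy, rfl⟩)
    · exact t.isBridge_graph hx
    · rw [Sym2.eq_swap]
      exact t.isBridge_graph hy

/-- The labelled rooted tree presented by a parent function. -/
def toPTree (t : ParentTree d) (lab : t.V → Fin p) : PTree p :=
  ⟨t.V, t.graph, t.isTree_graph, t.root, lab⟩

theorem heightLe_toPTree (t : ParentTree d) (lab : t.V → Fin p) : (t.toPTree lab).heightLe d :=
  fun v => let ⟨q, hq⟩ := t.exists_walk_length_le d v (t.iter_par v)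
    (SimpleGraph.dist_le q).trans hq

theorem exists_toStr_eq (t : PTree p) (ht : t.heightLe d) :
    ∃ (s : ParentTree d) (lab : s.V → Fin p), t.toStr = s.toStr lab := by
  choose q hq using t.tree.connected.exists_walk_length_eq_dist t.root
  have hpath : ∀ v, (q v).IsPath := fun v => (q v).isPath_of_length_eq_dist (hq v)
  have hnil : ∀ v, (q v).Nil ↔ v = t.root := fun v => by
    rw [← SimpleGraph.Walk.length_eq_zero_iff, hq, t.tree.connected.dist_eq_zero_iff, eq_comm]
  have hdist : ∀ m v, t.g.dist t.root v ≤ m → (fun v => (q v).penultimate)^[m] v = t.root := by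
    intro m
    induction m with
    | zero =>
      exact fun v hv => (t.tree.connected.dist_eq_zero_iff.1 (Nat.le_zero.1 hv)).symm
    | succ m ih =>
      refine fun v hv => ih _ ((SimpleGraph.dist_le (q v).dropLast).trans ?_)
      have := hq v
      rw [SimpleGraph.Walk.length_dropLast]
      omega
  have key : ∀ x y, t.g.Adj x y → y ∈ (q x).support → x ≠ t.root ∧ (q x).penultimate = y := by
    refine fun x y hxy hy => ⟨fun hx => ?_,
      (t.tree.isAcyclic.eq_penultimate_of_adj_end (hpath x) hxy hy).symm⟩
    have h := SimpleGraph.Walk.nil_iff_support_eq.1 ((hnil x).2 hx)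
    rw [h, List.mem_singleton] at hy
    exact hxy.ne (hx.trans hy.symm)
  have hadj : ∀ x, x ≠ t.root → t.g.Adj (q x).penultimate x := fun x hx =>
    (q x).adj_penultimate fun h => hx ((hnil x).1 h)
  refine ⟨⟨t.V, t.root, fun v => (q v).penultimate, ?_, fun v => hdist d v (ht v)⟩, t.label, ?_⟩
  · exact hdist 1 t.root (by simp)
  · have hE : t.g.Adj = fun x y => (x ≠ t.root ∧ (q x).penultimate = y) ∨
        (y ≠ t.root ∧ (q y).penultimate = x) := by
      ext x y
      constructor
      · intro h
        by_cases hy : y ∈ (q x).support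
        · exact .inl (key x y h hy)
        · exact .inr (key y x h.symm
            (t.tree.isAcyclic.mem_support_of_ne_mem_support_of_adj_of_isPath (hpath y) (hpath x)
              h.symm hy))
      · rintro (⟨hx, rfl⟩ | ⟨hy, rfl⟩)
        · exact (hadj x hx).symm
        · exact hadj y hy
    unfold PTree.toStr toStr
    rw [hE]

end PTree

end ParentTree

/-- MSO compactness over `T_{d,p}`: if every finite subset of a set `T` of MSO
sentences over the vocabulary of `p`-labeled rooted trees has a model in
`T_{d,p}`, then `T` has a model in `T_{d,p}`, and indeed an at most countable
one. -/
theorem stmt14 (d p : ℕ) (T : Set (MSOForm (Option (Fin p))))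
    (hT : ∀ φ ∈ T, φ.IsSentence)
    (hfin : ∀ T₀ : Set (MSOForm (Option (Fin p))), T₀ ⊆ T → T₀.Finite →
      ∃ t : PTree p, t.heightLe d ∧ ∀ φ ∈ T₀, t.toStr.Sat φ) :
    ∃ t : PTree p, t.heightLe d ∧ Countable t.V ∧ ∀ φ ∈ T, t.toStr.Sat φ := by
  have hmem : ∀ i : Finset T, ∃ (s : ParentTree d) (lab : s.V → Fin p),
      ∀ φ ∈ i, (s.toStr lab).Sat φ := by
    intro i
    obtain ⟨t, ht, hsat⟩ := hfin (Subtype.val '' (i : Set T)) (Subtype.coe_image_subset _ _)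
      (i.finite_toSet.image _)
    obtain ⟨s, lab, hs⟩ := ParentTree.exists_toStr_eq t ht
    exact ⟨s, lab, fun φ hφ => hs ▸ hsat φ ⟨φ, hφ, rfl⟩⟩
  choose F lab hF using hmem
  let U : Ultrafilter (Finset T) := Ultrafilter.of Filter.atTop
  let M := ParentTree.ultraproduct U F
  obtain ⟨labM, hlabM⟩ := ParentTree.exists_limit_color U lab
  have hcolor : ∀ x l, (∀ᶠ i in U, (lab i (x i), x i = (F i).root) = l) →
      (labM (ParentTree.ultraMk U F x), ParentTree.ultraMk U F x = M.root) = l := by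
    rintro x ⟨l, P⟩ h
    refine Prod.ext (hlabM x l (h.mono fun i hi => congrArg Prod.fst hi)) (propext ?_)
    refine (ParentTree.ultraMk_eq_iff U).trans ?_
    rw [Filter.eventually_congr (h.mono fun i hi => iff_of_eq (congrArg Prod.snd hi))]
    exact Filter.eventually_const
  obtain ⟨S, hroot, hpar, hcount, htype⟩ :=
    M.exists_countable_subtree fun x => (labM x, x = M.root)
  let N := M.subtree S hroot hpar
  have htypeN : ∀ n, N.type n (fun x => (labM x.1, x = N.root)) d N.root =
      M.type n (fun x => (labM x, x = M.root)) d M.root := by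
    intro n
    have hcol : (fun x : N.V => (labM x.1, x = N.root)) = fun x => (labM x.1, x.1 = M.root) :=
      funext fun x => Prod.ext rfl (propext Subtype.ext_iff)
    rw [hcol]
    exact htype n d N.root
  refine ⟨N.toPTree fun x => labM x.1, N.heightLe_toPTree _, hcount.to_subtype, fun φ hφ => ?_⟩
  obtain ⟨n, hn⟩ := ParentTree.exists_threshold_realize_root d p φ
  obtain ⟨τ, hτ⟩ := ParentTree.exists_eventually_eq U fun i =>
    (F i).type n (fun x => (lab i x, x = (F i).root)) d (F i).root
  have hMτ := ParentTree.type_ultraMk U (c' := fun x => (labM x, x = M.root)) hcolor d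
    (fun i => (F i).root) τ hτ
  have hφU : ∀ᶠ i : Finset T in U, ⟨φ, hφ⟩ ∈ i :=
    Ultrafilter.of_le _ ((Filter.eventually_ge_atTop {(⟨φ, hφ⟩ : T)}).mono fun i hi =>
      hi (Finset.mem_singleton_self _))
  obtain ⟨i, hi, hφi⟩ := (hτ.and hφU).exists
  refine (MStr.sat_iff_realize _ (hT φ hφ) (fun _ => N.root) fun _ => ∅).2 ?_
  exact hn (F i) N (lab i) (fun x => labM x.1) (hi.trans (hMτ.symm.trans (htypeN n).symm))
    (hF i ⟨φ, hφ⟩ hφi _ _)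
end
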